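/- Let q > 1, let γ be a probability measure on [q] = {1,…,q} with γ(i) > 0 for all i, and let h(t) = φ(Φ^{−1}(t)). There exists a universal constant c > 0 such that for any pair of increasing sets A, B ⊆ [q]^n, γ^{⊗n}(A ∩ B) − γ^{⊗n}(A)·γ^{⊗n}(B) ≥ c·max( ∑_{i=1}^n [I_i^h(A)·I_i^h(B)] / √(log(1/I_i^h(A))·log(1/I_i^h(B))), φ̃(∑_{i=1}^n I_i^h(A)·I_i^h(B)) ), where φ̃(x) = x / log(e/x). -/

import Mathlib

open MeasureTheory ProbabilityTheory Filter Pointwise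

noncomputable section

/-- The standard Gaussian measure on `ℝ`. -/
def stdGaussian : Measure ℝ := gaussianReal 0 1

/-- The `n`-fold product of the standard Gaussian measure on `ℝⁿ`. -/
def gaussianPi (n : ℕ) : Measure (Fin n → ℝ) := Measure.pi fun _ => stdGaussian

/-- Lower Minkowski content of a set `S ⊆ ℝ` w.r.t. the standard Gaussian measure. -/
def minkContent (S : Set ℝ) : ℝ :=
  Filter.liminf
    (fun r : ℝ =>
      ((stdGaussian (S + Set.Icc (-r) r)).toReal - (stdGaussian S).toReal) / r)
    (nhdsWithin 0 (Set.Ioi 0))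

/-- The restriction of `A` along the fiber of `x` in the `i`-th direction. -/
def fiber {n : ℕ} (A : Set (Fin n → ℝ)) (i : Fin n) (x : Fin n → ℝ) : Set ℝ :=
  {y : ℝ | Function.update x i y ∈ A}

/-- The geometric influence of coordinate `i` on `A`. -/
def geomInfluence {n : ℕ} (A : Set (Fin n → ℝ)) (i : Fin n) : ℝ :=
  ∫ x, minkContent (fiber A i x) ∂(gaussianPi n)

/-- A set is increasing if its indicator is nondecreasing in each coordinate. -/
def IncreasingSet {n : ℕ} (A : Set (Fin n → ℝ)) : Prop :=
  ∀ ⦃x y : Fin n → ℝ⦄, x ≤ y → x ∈ A → y ∈ A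

end


noncomputable section

/-- The standard normal distribution function `Φ`. -/
def Phi (u : ℝ) : ℝ := (stdGaussian (Set.Iic u)).toReal

end

noncomputable section

/-- The standard Gaussian density `φ(u) = (2π)^{−1/2}·e^{−u²/2}`. -/
def gphi (u : ℝ) : ℝ := (Real.sqrt (2 * Real.pi))⁻¹ * Real.exp (-(u ^ 2) / 2)

/-- The inverse `Φ⁻¹ : (0,1) → ℝ` of the standard normal distribution function. -/
def PhiInv (a : ℝ) : ℝ := sInf {u : ℝ | a ≤ Phi u}

open Classical in
/-- The function `h(t) = φ(Φ⁻¹(t))` for `t ∈ (0,1)`, with `h(t) = 0` for `t ∉ (0,1)`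
(in particular `h(0) = h(1) = 0`). -/
def hfun (a : ℝ) : ℝ := if a ≤ 0 ∨ 1 ≤ a then 0 else gphi (PhiInv a)

end

noncomputable section

/-- The `h`-influence of coordinate `i` on `A ⊆ [q]ⁿ` w.r.t. a measure `γ` on `[q]`:
`I_i^h(A) = E_{x∼γ^{⊗n}}[h(γ(A_i^x))]`. -/
def hInf {n q : ℕ} (γ : Measure (Fin q)) (A : Set (Fin n → Fin q)) (i : Fin n) : ℝ :=
  ∫ x, hfun ((γ {y : Fin q | Function.update x i y ∈ A}).toReal)
    ∂(Measure.pi fun _ : Fin n => γ)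

/-- A set `A ⊆ [q]ⁿ` is increasing if its indicator is nondecreasing in each coordinate. -/
def IncreasingSetQ {n q : ℕ} (A : Set (Fin n → Fin q)) : Prop :=
  ∀ ⦃x y : Fin n → Fin q⦄, x ≤ y → x ∈ A → y ∈ A

end

set_option linter.unusedSectionVars false
set_option linter.unusedSimpArgs false

namespace DPT

/-- The sign of a bit. -/
noncomputable def sg (b : Bool) : ℝ := if b then 1 else -1

@[simp] lemma sg_true : sg true = 1 := by simp [sg]
@[simp] lemma sg_false : sg false = -1 := by simp [sg]

lemma sg_mul_self (b : Bool) : sg b * sg b = 1 := by cases b <;> simp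

lemma sg_bound (ρ : ℝ) (h0 : 0 ≤ ρ) (h1 : ρ ≤ 1) (a b : Bool) : 0 ≤ 1 + ρ * (sg a * sg b) := by
  cases a <;> cases b <;> simp <;> linarith

section cube

variable {ι : Type*} [Fintype ι] [DecidableEq ι]

/-- Uniform average over the cube. -/
noncomputable def avg (F : (ι → Bool) → ℝ) : ℝ := (∑ x, F x) / 2 ^ Fintype.card ι

lemma avg_add (F G : (ι → Bool) → ℝ) : avg (fun x => F x + G x) = avg F + avg G := by
  simp [avg, Finset.sum_add_distrib, add_div]

lemma avg_sub (F G : (ι → Bool) → ℝ) : avg (fun x => F x - G x) = avg F - avg G := by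
  simp [avg, Finset.sum_sub_distrib, sub_div]

lemma avg_mul_left (c : ℝ) (F : (ι → Bool) → ℝ) : avg (fun x => c * F x) = c * avg F := by
  simp [avg, ← Finset.mul_sum, mul_div_assoc]

lemma avg_mul_right (c : ℝ) (F : (ι → Bool) → ℝ) : avg (fun x => F x * c) = avg F * c := by
  simp only [mul_comm _ c, avg_mul_left]

lemma avg_const (c : ℝ) : avg (fun _ : ι → Bool => c) = c := by
  simp [avg]

lemma avg_nonneg {F : (ι → Bool) → ℝ} (h : ∀ x, 0 ≤ F x) : 0 ≤ avg F :=
  div_nonneg (Finset.sum_nonneg fun x _ => h x) (by positivity)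

lemma avg_mono {F G : (ι → Bool) → ℝ} (h : ∀ x, F x ≤ G x) : avg F ≤ avg G := by
  unfold avg
  have := Finset.sum_le_sum (s := Finset.univ) fun x _ => h x
  gcongr

lemma avg_comm (F : (ι → Bool) → (ι → Bool) → ℝ) :
    avg (fun x => avg (fun y => F x y)) = avg (fun y => avg (fun x => F x y)) := by
  simp only [avg, ← Finset.sum_div]
  rw [Finset.sum_comm]

lemma avg_sum {κ : Type*} (s : Finset κ) (F : κ → (ι → Bool) → ℝ) :
    avg (fun x => ∑ k ∈ s, F k x) = ∑ k ∈ s, avg (F k) := by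
  simp only [avg, ← Finset.sum_div]
  rw [Finset.sum_comm]

/-- flipping coordinate `j`. -/
def flipAt (j : ι) : (ι → Bool) ≃ (ι → Bool) where
  toFun x := Function.update x j (!(x j))
  invFun x := Function.update x j (!(x j))
  left_inv x := by ext i; by_cases h : i = j <;> simp [Function.update_apply, h]
  right_inv x := by ext i; by_cases h : i = j <;> simp [Function.update_apply, h]

lemma avg_split (j : ι) (F : (ι → Bool) → ℝ) :
    avg F = avg (fun x => (F (Function.update x j true) + F (Function.update x j false)) / 2) := by
  have h1 : ∑ x, F x = ∑ x, F (flipAt j x) := (Equiv.sum_comp (flipAt j) F).symm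
  have h2 : ∀ x, F (Function.update x j true) + F (Function.update x j false)
      = F x + F (flipAt j x) := by
    intro x
    cases h : x j
    · have : Function.update x j false = x := by rw [← h]; simp
      rw [this, flipAt]
      simp [h, add_comm]
    · have : Function.update x j true = x := by rw [← h]; simp
      rw [this, flipAt]
      simp [h]
  unfold avg
  simp only [h2, ← Finset.sum_div, Finset.sum_add_distrib, ← h1]
  congr 1
  ring

/-- product kernel -/
noncomputable def ker (ρ : ℝ) (x y : ι → Bool) : ℝ := ∏ i, (1 + ρ * (sg (x i) * sg (y i)))

/-- product kernel with coordinate `j` left out -/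
noncomputable def kerE (j : ι) (ρ : ℝ) (x y : ι → Bool) : ℝ :=
  ∏ i ∈ Finset.univ.erase j, (1 + ρ * (sg (x i) * sg (y i)))

lemma ker_eq (j : ι) (ρ : ℝ) (x y : ι → Bool) :
    ker ρ x y = (1 + ρ * (sg (x j) * sg (y j))) * kerE j ρ x y := by
  unfold ker kerE
  rw [Finset.mul_prod_erase Finset.univ (fun i => 1 + ρ * (sg (x i) * sg (y i)))
    (Finset.mem_univ j)]

lemma kerE_update (j : ι) (ρ : ℝ) (x y : ι → Bool) (a b : Bool) :
    kerE j ρ (Function.update x j a) (Function.update y j b) = kerE j ρ x y := by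
  unfold kerE
  refine Finset.prod_congr rfl fun i hi => ?_
  have : i ≠ j := Finset.ne_of_mem_erase hi
  simp [Function.update_apply, this]

lemma ker_nonneg {ρ : ℝ} (h0 : 0 ≤ ρ) (h1 : ρ ≤ 1) (x y : ι → Bool) : 0 ≤ ker ρ x y :=
  Finset.prod_nonneg fun _ _ => sg_bound ρ h0 h1 _ _

lemma ker_symm (ρ : ℝ) (x y : ι → Bool) : ker ρ x y = ker ρ y x := by
  unfold ker; simp only [mul_comm]

/-- noise operator -/
noncomputable def T (ρ : ℝ) (f : (ι → Bool) → ℝ) (x : ι → Bool) : ℝ :=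
  avg fun y => f y * ker ρ x y

/-- noise bilinear form -/
noncomputable def H (f g : (ι → Bool) → ℝ) (ρ : ℝ) : ℝ :=
  avg fun x => avg fun y => f x * g y * ker ρ x y

/-- derivative in coordinate `j` of the bilinear form -/
noncomputable def Hj (j : ι) (f g : (ι → Bool) → ℝ) (ρ : ℝ) : ℝ :=
  avg fun x => avg fun y => f x * g y * (sg (x j) * sg (y j) * kerE j ρ x y)

/-- discrete derivative -/
noncomputable def D (j : ι) (f : (ι → Bool) → ℝ) (x : ι → Bool) : ℝ :=
  (f (Function.update x j true) - f (Function.update x j false)) / 2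

lemma D_update (j : ι) (f : (ι → Bool) → ℝ) (x : ι → Bool) (a : Bool) :
    D j f (Function.update x j a) = D j f x := by simp [D]

lemma H_eq_T (f g : (ι → Bool) → ℝ) (ρ : ℝ) : H f g ρ = avg fun x => f x * T ρ g x := by
  unfold H T
  simp only [← avg_mul_left, mul_assoc]

lemma H_symm (f g : (ι → Bool) → ℝ) (ρ : ℝ) : H f g ρ = H g f ρ := by
  unfold H
  rw [avg_comm]
  simp only [ker_symm ρ, mul_comm (f _)]

lemma Hj_eq (j : ι) (f g : (ι → Bool) → ℝ) (ρ : ℝ) :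
    Hj j f g ρ = H (D j f) (D j g) ρ := by
  have e1 : Hj j f g ρ = avg fun x => avg fun y => D j f x * D j g y * kerE j ρ x y := by
    unfold Hj
    rw [avg_split j]
    congr 1; ext x
    rw [← avg_add, div_eq_mul_inv, ← avg_mul_right, avg_split j]
    congr 1; ext y
    simp only [kerE_update, Function.update_self, D, sg_true, sg_false]
    ring
  have e2 : H (D j f) (D j g) ρ = avg fun x => avg fun y => D j f x * D j g y * kerE j ρ x y := by
    unfold H
    rw [avg_split j]
    congr 1; ext x
    rw [← avg_add, div_eq_mul_inv, ← avg_mul_right, avg_split j]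
    congr 1; ext y
    simp only [ker_eq j, D_update, kerE_update, Function.update_self, sg_true, sg_false]
    ring
  rw [e1, e2]

lemma hasDerivAt_avg {F : ℝ → (ι → Bool) → ℝ} {F' : (ι → Bool) → ℝ} {ρ : ℝ}
    (h : ∀ x, HasDerivAt (fun r => F r x) (F' x) ρ) :
    HasDerivAt (fun r => avg (F r)) (avg F') ρ := by
  unfold avg
  exact (HasDerivAt.fun_sum fun x _ => h x).div_const _

lemma hasDerivAt_H (f g : (ι → Bool) → ℝ) (ρ : ℝ) :
    HasDerivAt (H f g) (∑ j, Hj j f g ρ) ρ := by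
  have key : ∀ x y : ι → Bool, HasDerivAt (fun r => ker r x y)
      (∑ j, sg (x j) * sg (y j) * kerE j ρ x y) ρ := by
    intro x y
    have := HasDerivAt.fun_finsetProd (u := Finset.univ) (x := ρ)
      (f := fun i r => 1 + r * (sg (x i) * sg (y i)))
      (f' := fun i => sg (x i) * sg (y i)) (fun i _ => by
        simpa using ((hasDerivAt_id ρ).mul_const (sg (x i) * sg (y i))).const_add 1)
    refine this.congr_deriv ?_
    refine Finset.sum_congr rfl fun j _ => ?_
    simp [kerE, mul_comm]
  have : ∑ j, Hj j f g ρ = avg fun x => avg fun y => f x * g y *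
      ∑ j, sg (x j) * sg (y j) * kerE j ρ x y := by
    simp only [Finset.mul_sum, avg_sum]
    rfl
  rw [this]
  exact hasDerivAt_avg fun x => hasDerivAt_avg fun y => (key x y).const_mul _

lemma H_zero (f g : (ι → Bool) → ℝ) : H f g 0 = avg f * avg g := by
  simp [H, ker, avg_mul_left, avg_mul_right]

lemma H_one (f g : (ι → Bool) → ℝ) : H f g 1 = avg fun x => f x * g x := by
  rw [H_eq_T]
  congr 1; ext x
  congr 1
  have : ∀ y, ker 1 x y = if y = x then 2 ^ Fintype.card ι else 0 := by
    intro y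
    split_ifs with h
    · subst h
      simp [ker, sg_mul_self]
      norm_num
    · obtain ⟨i, hi⟩ := Function.ne_iff.1 h
      refine Finset.prod_eq_zero (Finset.mem_univ i) ?_
      revert hi
      cases x i <;> cases y i <;> simp
  simp [T, avg, this]

lemma ker_comp (σ τ : ℝ) (x z : ι → Bool) :
    avg (fun y => ker σ x y * ker τ y z) = ker (σ * τ) x z := by
  unfold avg ker
  simp only [← Finset.prod_mul_distrib]
  have := Finset.prod_univ_sum (fun _ : ι => (Finset.univ : Finset Bool))
    (fun i b => (1 + σ * (sg (x i) * sg b)) * (1 + τ * (sg b * sg (z i))))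
  simp only [Fintype.piFinset_univ] at this
  rw [← this, ← Finset.card_univ, ← Finset.prod_const, ← Finset.prod_div_distrib]
  refine Finset.prod_congr rfl fun i _ => ?_
  simp
  ring

lemma T_comp (σ τ : ℝ) (f : (ι → Bool) → ℝ) : T σ (T τ f) = T (σ * τ) f := by
  ext x
  unfold T
  simp only [← avg_mul_right, ← ker_comp σ τ x, ← avg_mul_left]
  rw [avg_comm]
  congr 1; ext y; congr 1; ext z; ring

lemma H_T_left (σ τ : ℝ) (f g : (ι → Bool) → ℝ) : H (T σ f) g τ = H f g (σ * τ) := by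
  rw [H_eq_T, H_eq_T f g, ← T_comp]
  generalize T τ g = G
  unfold T
  simp only [← avg_mul_right, ← avg_mul_left]
  rw [avg_comm]
  congr 1; ext y; congr 1; ext z
  rw [ker_symm σ z y]; ring

lemma H_T_T (σ τ : ℝ) (f g : (ι → Bool) → ℝ) : H (T σ f) (T σ g) τ = H f g (σ * σ * τ) := by
  rw [H_T_left, H_symm, H_T_left, H_symm, mul_assoc]

lemma T_nonneg {σ : ℝ} (h0 : 0 ≤ σ) (h1 : σ ≤ 1) {f : (ι → Bool) → ℝ} (hf : ∀ x, 0 ≤ f x)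
    (x : ι → Bool) : 0 ≤ T σ f x :=
  avg_nonneg fun y => mul_nonneg (hf y) (ker_nonneg h0 h1 _ _)

lemma avg_T (σ : ℝ) (f : (ι → Bool) → ℝ) : avg (T σ f) = avg f := by
  have h1 := H_T_left σ 0 f (fun _ => 1)
  rw [mul_zero, H_zero, H_zero, avg_const] at h1
  simpa using h1

lemma H_nonneg {f g : (ι → Bool) → ℝ} (hf : ∀ x, 0 ≤ f x) (hg : ∀ x, 0 ≤ g x) {ρ : ℝ}
    (h0 : 0 ≤ ρ) (h1 : ρ ≤ 1) : 0 ≤ H f g ρ :=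
  avg_nonneg fun x => avg_nonneg fun y =>
    mul_nonneg (mul_nonneg (hf x) (hg y)) (ker_nonneg h0 h1 _ _)

lemma H_self_eq (f : (ι → Bool) → ℝ) {ρ : ℝ} (h0 : 0 ≤ ρ) :
    H f f ρ = avg fun x => T (√ρ) f x * T (√ρ) f x := by
  rw [← H_one, H_T_T, mul_one, Real.mul_self_sqrt h0]

lemma H_self_nonneg (f : (ι → Bool) → ℝ) {ρ : ℝ} (h0 : 0 ≤ ρ) : 0 ≤ H f f ρ := by
  rw [H_self_eq f h0]
  exact avg_nonneg fun x => mul_self_nonneg _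

lemma H_self_mono (f : (ι → Bool) → ℝ) {ρ τ : ℝ} (h0 : 0 ≤ ρ) (h1 : ρ ≤ τ) :
    H f f ρ ≤ H f f τ := by
  have : MonotoneOn (H f f) (Set.Ici 0) := by
    refine monotoneOn_of_deriv_nonneg (convex_Ici 0)
      (fun x _ => (hasDerivAt_H f f x).continuousAt.continuousWithinAt)
      (fun x _ => (hasDerivAt_H f f x).differentiableAt.differentiableWithinAt) ?_
    intro x hx
    rw [interior_Ici] at hx
    rw [(hasDerivAt_H f f x).deriv]
    exact Finset.sum_nonneg fun j _ => by rw [Hj_eq]; exact H_self_nonneg _ (le_of_lt hx)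
  exact this h0 (h0.trans h1) h1

/-- derivative of the form against the variance -/
lemma sum_Hj_self_le (f : (ι → Bool) → ℝ) {ρ : ℝ} (h0 : 0 ≤ ρ) (h1 : ρ < 1) :
    (∑ j, Hj j f f ρ) * (1 - ρ) ≤ avg (fun x => f x * f x) - avg f * avg f := by
  have hm := H_self_mono f le_rfl h0
  rw [H_zero] at hm
  rw [← H_one]
  obtain ⟨c, hc, hc'⟩ := exists_hasDerivAt_eq_slope (H f f) (fun ρ => ∑ j, Hj j f f ρ) h1
    (fun x _ => (hasDerivAt_H f f x).continuousAt.continuousWithinAt)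
    (fun x _ => hasDerivAt_H f f x)
  have h2 : ∑ j, Hj j f f ρ ≤ ∑ j, Hj j f f c := Finset.sum_le_sum fun j _ => by
    rw [Hj_eq, Hj_eq]; exact H_self_mono _ h0 hc.1.le
  rw [hc', le_div_iff₀ (by linarith)] at h2
  linarith

/-- `H f g 1 - H f g 0` as a sum of integrals. -/
lemma H_sub_eq (f g : (ι → Bool) → ℝ) :
    avg (fun x => f x * g x) - avg f * avg g = ∑ j, ∫ ρ in (0:ℝ)..1, Hj j f g ρ := by
  have hc : ∀ j, Continuous (Hj j f g) := fun j => by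
    have : Hj j f g = H (D j f) (D j g) := by ext ρ; exact Hj_eq j f g ρ
    rw [this]
    exact continuous_iff_continuousAt.2 fun x => (hasDerivAt_H _ _ x).continuousAt
  rw [← H_one, ← H_zero, ← intervalIntegral.integral_finsetSum
    (fun j _ => (hc j).intervalIntegrable _ _)]
  rw [intervalIntegral.integral_eq_sub_of_hasDerivAt (fun x _ => hasDerivAt_H f g x)]
  exact (continuous_finsetSum _ fun j _ => hc j).intervalIntegrable _ _

end cube
end DPT

set_option linter.unusedSectionVars false
set_option linter.unusedSimpArgs false

namespace DPT

lemma concave_aux {p : ℝ} (h0 : 0 < p) (h1 : p < 1) :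
    ConcaveOn ℝ (Set.Icc (0:ℝ) 2) (fun u : ℝ => u ^ p + p * (1 - p) / 8 * (u - 1) ^ 2) := by
  refine concaveOn_of_hasDerivWithinAt2_nonpos (convex_Icc 0 2)
    (f' := fun u => p * u ^ (p - 1) + p * (1 - p) / 4 * (u - 1))
    (f'' := fun u => p * ((p - 1) * u ^ (p - 2)) + p * (1 - p) / 4) ?_ ?_ ?_ ?_
  · exact ((Real.continuous_rpow_const h0.le).add (by fun_prop)).continuousOn
  · intro u hu
    rw [interior_Icc] at hu
    have a1 := Real.hasDerivAt_rpow_const (x := u) (p := p) (Or.inl hu.1.ne')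
    have a2 := (((hasDerivAt_id u).sub_const 1).pow 2).const_mul (p * (1 - p) / 8)
    refine ((a1.add a2).congr_deriv ?_).hasDerivWithinAt
    simp
    ring
  · intro u hu
    rw [interior_Icc] at hu
    have a1 := (Real.hasDerivAt_rpow_const (x := u) (p := p - 1) (Or.inl hu.1.ne')).const_mul p
    have a2 := ((hasDerivAt_id u).sub_const 1).const_mul (p * (1 - p) / 4)
    refine ((a1.add a2).congr_deriv ?_).hasDerivWithinAt
    rw [show p - 1 - 1 = p - 2 by ring]
    simp
  · intro u hu
    rw [interior_Icc] at hu
    have b1 : (1:ℝ) / 4 ≤ u ^ (p - 2) := by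
      have c1 : (2:ℝ) ^ (p - 2) ≤ u ^ (p - 2) :=
        Real.rpow_le_rpow_of_nonpos hu.1 hu.2.le (by linarith)
      have c2 : (2:ℝ) ^ (-2 : ℝ) ≤ (2:ℝ) ^ (p - 2) :=
        Real.rpow_le_rpow_of_exponent_le (by norm_num) (by linarith)
      have c3 : (2:ℝ) ^ (-2 : ℝ) = 1 / 4 := by
        rw [Real.rpow_neg (by norm_num)]; norm_num
      rw [c3] at c2
      exact c2.trans c1
    have b2 : 0 < p * (1 - p) := mul_pos h0 (by linarith)
    nlinarith

lemma two_pt_norm {p : ℝ} (h0 : 0 < p) (h1 : p < 1) {A a : ℝ} (hA : 0 ≤ A) (ha : |a| ≤ 1) :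
    (((A * (1 + a)) ^ p + (A * (1 - a)) ^ p) / 2) ^ (1 / p)
      ≤ A * Real.exp (-((1 - p) * a ^ 2 / 8)) := by
  obtain ⟨ha1, ha2⟩ := abs_le.1 ha
  have m1 : 1 + a ∈ Set.Icc (0:ℝ) 2 := ⟨by linarith, by linarith⟩
  have m2 : 1 - a ∈ Set.Icc (0:ℝ) 2 := ⟨by linarith, by linarith⟩
  have k := (concave_aux h0 h1).2 m1 m2
    (show (0:ℝ) ≤ 1 / 2 by norm_num) (show (0:ℝ) ≤ 1 / 2 by norm_num) (by norm_num)
  simp only [smul_eq_mul] at k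
  rw [show (1:ℝ) / 2 * (1 + a) + 1 / 2 * (1 - a) = 1 by ring, Real.one_rpow] at k
  have k2 : ((1 + a) ^ p + (1 - a) ^ p) / 2 ≤ Real.exp (-((1 - p) * a ^ 2 / 8) * p) := by
    have := Real.add_one_le_exp (-((1 - p) * a ^ 2 / 8) * p)
    nlinarith
  have n1 : 0 ≤ (1 + a) ^ p := Real.rpow_nonneg (by linarith) _
  have n2 : 0 ≤ (1 - a) ^ p := Real.rpow_nonneg (by linarith) _
  rw [Real.mul_rpow hA (by linarith), Real.mul_rpow hA (by linarith), ← mul_add, mul_div_assoc,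
    Real.mul_rpow (Real.rpow_nonneg hA _) (by positivity), ← Real.rpow_mul hA,
    mul_one_div_cancel h0.ne', Real.rpow_one]
  refine mul_le_mul_of_nonneg_left ?_ hA
  calc _ ≤ (Real.exp (-((1 - p) * a ^ 2 / 8) * p)) ^ (1 / p) :=
        Real.rpow_le_rpow (by positivity) k2 (by positivity)
    _ = _ := by
        rw [← Real.exp_mul]; congr 1; field_simp

/-- write two nonnegative numbers as `A (1 + a)`, `A (1 - a)`. -/
lemma exists_form {u v : ℝ} (hu : 0 ≤ u) (hv : 0 ≤ v) :
    ∃ A a : ℝ, 0 ≤ A ∧ |a| ≤ 1 ∧ u = A * (1 + a) ∧ v = A * (1 - a) := by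
  rcases eq_or_lt_of_le (add_nonneg hu hv) with h | h
  · exact ⟨0, 0, le_rfl, by simp, by linarith, by linarith⟩
  · refine ⟨(u + v) / 2, (u - v) / (u + v), by linarith, ?_, ?_, ?_⟩
    · rw [abs_div, abs_of_pos h, div_le_one h, abs_le]; constructor <;> linarith
    · field_simp; ring
    · field_simp; ring

lemma exp_aux {x : ℝ} (h0 : 0 ≤ x) (h1 : x ≤ 1 / 2) : Real.exp (-(2 * x)) ≤ 1 - x := by
  have h := Real.add_one_le_exp (2 * x)
  have h2 := Real.quadratic_le_exp_of_nonneg (x := 2 * x) (by linarith)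
  rw [Real.exp_neg, inv_le_comm₀ (Real.exp_pos _) (by linarith)]
  refine le_trans ?_ h2
  rw [inv_le_iff_one_le_mul₀ (by linarith)]
  nlinarith [mul_nonneg h0 h0, mul_nonneg (mul_nonneg h0 h0) h0]

lemma two_pt {p q ρ : ℝ} (hp0 : 0 < p) (hp1 : p < 1) (hq0 : 0 < q) (hq1 : q < 1)
    (hρ0 : 0 ≤ ρ) (hρ1 : ρ ≤ 1 / 2) (hpq : 64 * ρ ^ 2 ≤ (1 - p) * (1 - q))
    {u v w z : ℝ} (hu : 0 ≤ u) (hv : 0 ≤ v) (hw : 0 ≤ w) (hz : 0 ≤ z) :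
    ((u ^ p + v ^ p) / 2) ^ (1 / p) * ((w ^ q + z ^ q) / 2) ^ (1 / q) ≤
      ((1 + ρ) * (u * w) + (1 - ρ) * (u * z) + (1 - ρ) * (v * w) + (1 + ρ) * (v * z)) / 4 := by
  obtain ⟨A, a, hA, ha, rfl, rfl⟩ := exists_form hu hv
  obtain ⟨B, b, hB, hb, rfl, rfl⟩ := exists_form hw hz
  have e1 := two_pt_norm hp0 hp1 hA ha
  have e2 := two_pt_norm hq0 hq1 hB hb
  have hab : |a| * |b| ≤ 1 := by
    nlinarith [abs_nonneg a, abs_nonneg b]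
  have hab0 : 0 ≤ |a| * |b| := by positivity
  have x1 : ρ * (|a| * |b|) ≤ 1 / 2 := by nlinarith
  have x0 : 0 ≤ ρ * (|a| * |b|) := by positivity
  have key : 2 * (ρ * (|a| * |b|)) ≤ (1 - p) * a ^ 2 / 8 + (1 - q) * b ^ 2 / 8 := by
    have s1 : 0 ≤ (1 - p) * a ^ 2 / 8 + (1 - q) * b ^ 2 / 8 := by
      have : 0 ≤ 1 - p := by linarith
      have : 0 ≤ 1 - q := by linarith
      positivity
    refine abs_le_of_sq_le_sq' ?_ s1 |>.2
    have s2 : (2 * (ρ * (|a| * |b|))) ^ 2 = 4 * ρ ^ 2 * (a ^ 2 * b ^ 2) := by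
      rw [mul_pow, mul_pow, mul_pow, sq_abs, sq_abs]; ring
    rw [s2]
    have s3 : 64 * ρ ^ 2 * (a ^ 2 * b ^ 2) ≤ (1 - p) * (1 - q) * (a ^ 2 * b ^ 2) :=
      mul_le_mul_of_nonneg_right hpq (by positivity)
    nlinarith [sq_nonneg ((1 - p) * a ^ 2 - (1 - q) * b ^ 2)]
  have f1 := exp_aux x0 x1
  have f2 : Real.exp (-((1 - p) * a ^ 2 / 8)) * Real.exp (-((1 - q) * b ^ 2 / 8))
      ≤ 1 + ρ * (a * b) := by
    rw [← Real.exp_add]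
    have : Real.exp (-((1 - p) * a ^ 2 / 8) + -((1 - q) * b ^ 2 / 8))
        ≤ Real.exp (-(2 * (ρ * (|a| * |b|)))) := Real.exp_le_exp.2 (by linarith)
    have : -(|a| * |b|) ≤ a * b := by rw [← abs_mul]; exact neg_abs_le _
    nlinarith
  obtain ⟨ha1, ha2⟩ := abs_le.1 ha
  obtain ⟨hb1, hb2⟩ := abs_le.1 hb
  calc _ ≤ (A * Real.exp (-((1 - p) * a ^ 2 / 8))) * (B * Real.exp (-((1 - q) * b ^ 2 / 8))) := by
        refine mul_le_mul e1 e2 ?_ (by positivity)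
        have n1 : 0 ≤ (B * (1 + b)) ^ q := Real.rpow_nonneg (mul_nonneg hB (by linarith)) _
        have n2 : 0 ≤ (B * (1 - b)) ^ q := Real.rpow_nonneg (mul_nonneg hB (by linarith)) _
        positivity
    _ = A * B * (Real.exp (-((1 - p) * a ^ 2 / 8)) * Real.exp (-((1 - q) * b ^ 2 / 8))) := by ring
    _ ≤ A * B * (1 + ρ * (a * b)) := mul_le_mul_of_nonneg_left f2 (by positivity)
    _ = _ := by ring

lemma avg_cons {N : ℕ} (F : (Fin (N + 1) → Bool) → ℝ) :
    avg F = (avg (fun x => F (Fin.cons true x)) + avg (fun x => F (Fin.cons false x))) / 2 := by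
  unfold avg
  rw [← (Fin.consEquiv (fun _ => Bool)).sum_comp F, Fintype.sum_prod_type]
  simp [Fin.consEquiv, pow_succ]
  ring

lemma ker_cons {N : ℕ} (ρ : ℝ) (a b : Bool) (x y : Fin N → Bool) :
    ker ρ (Fin.cons a x : Fin (N + 1) → Bool) (Fin.cons b y) =
      (1 + ρ * (sg a * sg b)) * ker ρ x y := by
  simp [ker, Fin.prod_univ_succ]

lemma H_cons {N : ℕ} (ρ : ℝ) (F G : (Fin (N + 1) → Bool) → ℝ) :
    H F G ρ = ((1 + ρ) * H (fun x => F (Fin.cons true x)) (fun x => G (Fin.cons true x)) ρ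
      + (1 - ρ) * H (fun x => F (Fin.cons true x)) (fun x => G (Fin.cons false x)) ρ
      + (1 - ρ) * H (fun x => F (Fin.cons false x)) (fun x => G (Fin.cons true x)) ρ
      + (1 + ρ) * H (fun x => F (Fin.cons false x)) (fun x => G (Fin.cons false x)) ρ) / 4 := by
  unfold H
  simp only [avg_cons (N := N), ker_cons, sg_true, sg_false, ← avg_mul_left, ← avg_add,
    div_eq_mul_inv, ← avg_mul_right]
  congr 1; ext x; congr 1; ext y; ring

lemma rhc_fin {p q ρ : ℝ} (hp0 : 0 < p) (hp1 : p < 1) (hq0 : 0 < q) (hq1 : q < 1)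
    (hρ0 : 0 ≤ ρ) (hρ1 : ρ ≤ 1 / 2) (hpq : 64 * ρ ^ 2 ≤ (1 - p) * (1 - q)) :
    ∀ (N : ℕ) (F G : (Fin N → Bool) → ℝ), (∀ x, 0 ≤ F x) → (∀ x, 0 ≤ G x) →
    (avg fun x => F x ^ p) ^ (1 / p) * (avg fun x => G x ^ q) ^ (1 / q) ≤ H F G ρ := by
  intro N
  induction N with
  | zero =>
    intro F G hF hG
    simp [H, avg, ker]
    rw [Real.rpow_rpow_inv (hF _) hp0.ne', Real.rpow_rpow_inv (hG _) hq0.ne']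
  | succ N ih =>
    intro F G hF hG
    rw [H_cons, avg_cons, avg_cons]
    have A1 : ∀ b, 0 ≤ avg fun x => F (Fin.cons b x) ^ p := fun b =>
      avg_nonneg fun x => Real.rpow_nonneg (hF _) _
    have A2 : ∀ b, 0 ≤ avg fun x => G (Fin.cons b x) ^ q := fun b =>
      avg_nonneg fun x => Real.rpow_nonneg (hG _) _
    have k := two_pt hp0 hp1 hq0 hq1 hρ0 hρ1 hpq
      (Real.rpow_nonneg (A1 true) (1 / p)) (Real.rpow_nonneg (A1 false) (1 / p))
      (Real.rpow_nonneg (A2 true) (1 / q)) (Real.rpow_nonneg (A2 false) (1 / q))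
    simp only [one_div] at k ⊢
    rw [Real.rpow_inv_rpow (A1 _) hp0.ne', Real.rpow_inv_rpow (A1 _) hp0.ne',
      Real.rpow_inv_rpow (A2 _) hq0.ne', Real.rpow_inv_rpow (A2 _) hq0.ne'] at k
    refine k.trans ?_
    have i := fun a b => ih (fun x => F (Fin.cons a x)) (fun x => G (Fin.cons b x))
      (fun x => hF _) (fun x => hG _)
    simp only [one_div] at i
    have r1 : 0 ≤ 1 - ρ := by linarith
    have := i true true
    have := i true false
    have := i false true
    have := i false false
    gcongr

section
variable {ι : Type*} [Fintype ι] [DecidableEq ι] {κ : Type*} [Fintype κ] [DecidableEq κ]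

lemma avg_equiv (e : κ ≃ ι) (F : (ι → Bool) → ℝ) : avg F = avg (fun x : κ → Bool => F (x ∘ e.symm)) := by
  unfold avg
  rw [Fintype.card_congr e, ← (e.arrowCongr (Equiv.refl Bool)).sum_comp F]
  rfl

lemma ker_equiv (e : κ ≃ ι) (ρ : ℝ) (x y : κ → Bool) :
    ker ρ (x ∘ e.symm) (y ∘ e.symm) = ker ρ x y := by
  unfold ker
  rw [← e.symm.prod_comp (fun i => 1 + ρ * (sg (x i) * sg (y i)))]
  rfl

lemma H_equiv (e : κ ≃ ι) (F G : (ι → Bool) → ℝ) (ρ : ℝ) :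
    H F G ρ = H (fun x : κ → Bool => F (x ∘ e.symm)) (fun x => G (x ∘ e.symm)) ρ := by
  unfold H
  rw [avg_equiv e]
  congr 1; ext x
  rw [avg_equiv e]
  simp only [ker_equiv]

/-- **Reverse hypercontractivity** on the cube. -/
lemma rhc {p q ρ : ℝ} (hp0 : 0 < p) (hp1 : p < 1) (hq0 : 0 < q) (hq1 : q < 1)
    (hρ0 : 0 ≤ ρ) (hρ1 : ρ ≤ 1 / 2) (hpq : 64 * ρ ^ 2 ≤ (1 - p) * (1 - q))
    (F G : (ι → Bool) → ℝ) (hF : ∀ x, 0 ≤ F x) (hG : ∀ x, 0 ≤ G x) :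
    (avg fun x => F x ^ p) ^ (1 / p) * (avg fun x => G x ^ q) ^ (1 / q) ≤ H F G ρ := by
  have e := (Fintype.equivFin ι).symm
  rw [H_equiv e, avg_equiv e, avg_equiv e (fun x => G x ^ q)]
  exact rhc_fin hp0 hp1 hq0 hq1 hρ0 hρ1 hpq _ _ _ (fun x => hF _) (fun x => hG _)

end
end DPT

set_option linter.unusedSectionVars false

namespace DPT
section
variable {ι : Type*} [Fintype ι] [DecidableEq ι]

lemma young_aux {p t : ℝ} (hp0 : 0 < p) (hp1 : p < 1) (ht : 0 ≤ t) :
    (2 - p) * t - (1 - p) * t ^ 2 ≤ t ^ p := by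
  have h2 : 0 < 2 - p := by linarith
  have k := Real.geom_mean_le_arith_mean2_weighted (w₁ := 1 / (2 - p)) (w₂ := (1 - p) / (2 - p))
    (p₁ := t ^ p) (p₂ := t ^ (2:ℝ)) (by positivity) (div_nonneg (by linarith) h2.le)
    (Real.rpow_nonneg ht _) (Real.rpow_nonneg ht _) (by field_simp; ring)
  rw [← Real.rpow_mul ht, ← Real.rpow_mul ht, ← Real.rpow_add' ht (by
    have : p * (1 / (2 - p)) + 2 * ((1 - p) / (2 - p)) = 1 := by field_simp; ring
    rw [this]; norm_num)] at k
  have : p * (1 / (2 - p)) + 2 * ((1 - p) / (2 - p)) = 1 := by field_simp; ring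
  rw [this, Real.rpow_one, Real.rpow_two] at k
  have k2 : (2 - p) * t ≤ (2 - p) * (1 / (2 - p) * t ^ p + (1 - p) / (2 - p) * t ^ 2) :=
    mul_le_mul_of_nonneg_left k h2.le
  have k3 : (2 - p) * (1 / (2 - p) * t ^ p + (1 - p) / (2 - p) * t ^ 2)
      = t ^ p + (1 - p) * t ^ 2 := by field_simp
  linarith

lemma avg_sq_le (F : (ι → Bool) → ℝ) : avg F ^ 2 ≤ avg (fun x => F x * F x) := by
  have h : 0 ≤ avg (fun x => (F x - avg F) * (F x - avg F)) :=
    avg_nonneg fun x => mul_self_nonneg _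
  have e : avg (fun x => (F x - avg F) * (F x - avg F))
      = avg (fun x => F x * F x) - avg F ^ 2 := by
    have : (fun x => (F x - avg F) * (F x - avg F))
        = fun x => (F x * F x - 2 * avg F * F x) + avg F ^ 2 := by ext x; ring
    rw [this, avg_add, avg_sub, avg_mul_left, avg_const]; ring
  linarith

lemma interp {p : ℝ} (hp0 : 1 / 2 ≤ p) (hp1 : p < 1) (F : (ι → Bool) → ℝ) (hF : ∀ x, 0 ≤ F x) :
    avg F * (avg F ^ 2 / avg (fun x => F x * F x)) ^ (2 * (1 - p))
      ≤ (avg fun x => F x ^ p) ^ (1 / p) := by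
  have hp : 0 < p := by linarith
  rcases eq_or_lt_of_le (avg_nonneg hF) with h | h
  · rw [← h, zero_mul]
    exact Real.rpow_nonneg (avg_nonneg fun x => Real.rpow_nonneg (hF x) _) _
  set a := avg F with ha
  set m := avg (fun x => F x * F x) with hm
  have ham : a ^ 2 ≤ m := avg_sq_le F
  have hm0 : 0 < m := lt_of_lt_of_le (by positivity) ham
  have hs : 0 < m / a := by positivity
  have k : a ^ 2 / m * (m / a) ^ p ≤ avg fun x => F x ^ p := by
    have k1 : ∀ x, ((2 - p) * (a / m) * F x - (1 - p) * (a / m) ^ 2 * (F x * F x)) * (m / a) ^ p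
        ≤ F x ^ p := by
      intro x
      have := young_aux hp hp1 (t := F x * (a / m)) (mul_nonneg (hF x) (by positivity))
      rw [Real.mul_rpow (hF x) (by positivity)] at this
      have c : (a / m) ^ p * (m / a) ^ p = 1 := by
        rw [← Real.mul_rpow (by positivity) (by positivity)]
        rw [show a / m * (m / a) = 1 by field_simp, Real.one_rpow]
      calc _ = ((2 - p) * (F x * (a / m)) - (1 - p) * (F x * (a / m)) ^ 2) * (m / a) ^ p := by ring
        _ ≤ (F x ^ p * (a / m) ^ p) * (m / a) ^ p :=
            mul_le_mul_of_nonneg_right this (by positivity)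
        _ = F x ^ p := by rw [mul_assoc, c, mul_one]
    refine le_trans (le_of_eq ?_) (avg_mono k1)
    rw [avg_mul_right, avg_sub, avg_mul_left, avg_mul_left, ← ha, ← hm]
    congr 1
    field_simp
    ring
  have k2 := Real.rpow_le_rpow (by positivity) k (show 0 ≤ 1 / p by positivity)
  refine le_trans ?_ k2
  rw [Real.mul_rpow (by positivity) (by positivity), ← Real.rpow_mul hs.le,
    mul_one_div_cancel hp.ne', Real.rpow_one]
  have e : a ^ 2 / m = a ^ 2 / m := rfl
  have hle : a ^ 2 / m ≤ 1 := (div_le_one hm0).2 ham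
  have hpos : 0 < a ^ 2 / m := by positivity
  have e2 : (a ^ 2 / m) ^ (1 / p) * (m / a) = a * (a ^ 2 / m) ^ (1 / p - 1) := by
    rw [Real.rpow_sub_one hpos.ne']; field_simp
  rw [e2]
  refine mul_le_mul_of_nonneg_left ?_ h.le
  refine Real.rpow_le_rpow_of_exponent_ge hpos hle ?_
  rw [sub_le_iff_le_add, div_le_iff₀ hp]
  nlinarith

/-- second moment of the smoothed derivative -/
noncomputable def mj (j : ι) (f : (ι → Bool) → ℝ) : ℝ := Hj j f f (1 / 2)

lemma mj_eq (j : ι) (f : (ι → Bool) → ℝ) :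
    mj j f = avg fun x => T (√(1 / 2)) (D j f) x * T (√(1 / 2)) (D j f) x := by
  rw [mj, Hj_eq, H_self_eq _ (by norm_num)]

lemma sq_le_mj (j : ι) (f : (ι → Bool) → ℝ) : avg (D j f) ^ 2 ≤ mj j f := by
  rw [mj_eq, ← avg_T (√(1 / 2)) (D j f)]
  exact avg_sq_le _

lemma mj_nonneg (j : ι) (f : (ι → Bool) → ℝ) : 0 ≤ mj j f := (sq_nonneg _).trans (sq_le_mj j f)

lemma key_bound (j : ι) (f g : (ι → Bool) → ℝ) (hf : ∀ x, 0 ≤ D j f x) (hg : ∀ x, 0 ≤ D j g x)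
    {ρ s t : ℝ} (hρ : 0 ≤ ρ) (hs : 0 < s) (hs1 : s ≤ 1) (ht : 0 < t) (ht1 : t ≤ 1)
    (h : 1024 * ρ ^ 2 ≤ s * t) :
    avg (D j f) * (avg (D j f) ^ 2 / mj j f) ^ s * (avg (D j g) * (avg (D j g) ^ 2 / mj j g) ^ t)
      ≤ Hj j f g ρ := by
  have hρ2 : 2 * ρ ≤ 1 / 2 := by nlinarith
  have e : Hj j f g ρ = H (T (√(1 / 2)) (D j f)) (T (√(1 / 2)) (D j g)) (2 * ρ) := by
    rw [H_T_T, Real.mul_self_sqrt (by norm_num), Hj_eq]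
    congr 1; ring
  have s0 : 0 ≤ √((1:ℝ) / 2) := Real.sqrt_nonneg _
  have s1 : √((1:ℝ) / 2) ≤ 1 := Real.sqrt_le_one.2 (by norm_num)
  have pF := T_nonneg s0 s1 hf
  have pG := T_nonneg s0 s1 hg
  rw [e]
  refine le_trans ?_ (rhc (p := 1 - s / 2) (q := 1 - t / 2) (by linarith) (by linarith)
    (by linarith) (by linarith) (by linarith) hρ2 (by nlinarith) _ _ pF pG)
  have i1 := interp (p := 1 - s / 2) (by linarith) (by linarith) _ pF
  have i2 := interp (p := 1 - t / 2) (by linarith) (by linarith) _ pG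
  rw [avg_T, ← mj_eq, show 2 * (1 - (1 - s / 2)) = s by ring] at i1
  rw [avg_T, ← mj_eq, show 2 * (1 - (1 - t / 2)) = t by ring] at i2
  refine mul_le_mul i1 i2 ?_ ?_
  · exact mul_nonneg (avg_nonneg hg) (Real.rpow_nonneg (div_nonneg (sq_nonneg _) (mj_nonneg _ _)) _)
  · exact Real.rpow_nonneg (avg_nonneg fun x => Real.rpow_nonneg (pF x) _) _

lemma continuous_Hj (j : ι) (f g : (ι → Bool) → ℝ) : Continuous (Hj j f g) := by
  have : Hj j f g = H (D j f) (D j g) := by ext ρ; exact Hj_eq j f g ρ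
  rw [this]
  exact continuous_iff_continuousAt.2 fun x => (hasDerivAt_H _ _ x).continuousAt

lemma integral_Hj_ge (j : ι) (f g : (ι → Bool) → ℝ) (hf : ∀ x, 0 ≤ D j f x)
    (hg : ∀ x, 0 ≤ D j g x)
    {r s t : ℝ} (hr : 0 ≤ r) (hs : 0 < s) (hs1 : s ≤ 1) (ht : 0 < t) (ht1 : t ≤ 1)
    (h : 1024 * r ^ 2 ≤ s * t) :
    r * (avg (D j f) * (avg (D j f) ^ 2 / mj j f) ^ s *
      (avg (D j g) * (avg (D j g) ^ 2 / mj j g) ^ t)) ≤ ∫ ρ in (0:ℝ)..1, Hj j f g ρ := by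
  have hr1 : r ≤ 1 := by nlinarith
  have c := continuous_Hj j f g
  rw [← intervalIntegral.integral_add_adjacent_intervals (c.intervalIntegrable 0 r)
    (c.intervalIntegrable r 1)]
  have i2 : 0 ≤ ∫ ρ in r..1, Hj j f g ρ := by
    refine intervalIntegral.integral_nonneg hr1 fun u hu => ?_
    rw [Hj_eq]
    exact H_nonneg hf hg (hr.trans hu.1) hu.2
  set C := avg (D j f) * (avg (D j f) ^ 2 / mj j f) ^ s *
      (avg (D j g) * (avg (D j g) ^ 2 / mj j g) ^ t) with hC
  have i1 : r * C ≤ ∫ ρ in (0:ℝ)..r, Hj j f g ρ := by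
    have := intervalIntegral.integral_mono_on (μ := volume) (f := fun _ => C) hr
      (by simp) (c.intervalIntegrable 0 r) (fun ρ hρ =>
      key_bound j f g hf hg hρ.1 hs hs1 ht ht1
        (le_trans (by have := hρ.1; have := hρ.2; gcongr) h))
    simpa using this
  linarith

lemma cov_ge (f g : (ι → Bool) → ℝ) (hf : ∀ j x, 0 ≤ D j f x) (hg : ∀ j x, 0 ≤ D j g x)
    (r s t : ι → ℝ) (hr : ∀ j, 0 ≤ r j) (hs : ∀ j, 0 < s j) (hs1 : ∀ j, s j ≤ 1)
    (ht : ∀ j, 0 < t j) (ht1 : ∀ j, t j ≤ 1) (h : ∀ j, 1024 * r j ^ 2 ≤ s j * t j) :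
    ∑ j, r j * (avg (D j f) * (avg (D j f) ^ 2 / mj j f) ^ s j *
      (avg (D j g) * (avg (D j g) ^ 2 / mj j g) ^ t j))
      ≤ avg (fun x => f x * g x) - avg f * avg g := by
  rw [H_sub_eq]
  exact Finset.sum_le_sum fun j _ => integral_Hj_ge j f g (hf j) (hg j) (hr j) (hs j) (hs1 j)
    (ht j) (ht1 j) (h j)

lemma cov_nonneg (f g : (ι → Bool) → ℝ) (hf : ∀ j x, 0 ≤ D j f x) (hg : ∀ j x, 0 ≤ D j g x) :
    0 ≤ avg (fun x => f x * g x) - avg f * avg g := by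
  have := cov_ge f g hf hg (fun _ => 0) (fun _ => 1) (fun _ => 1) (by simp) (by simp) (by simp)
    (by simp) (by simp) (by simp)
  simpa using this

lemma var_le (f : (ι → Bool) → ℝ) (h0 : ∀ x, 0 ≤ f x) (h1 : ∀ x, f x ≤ 1) :
    avg (fun x => f x * f x) - avg f * avg f ≤ 1 / 4 := by
  have : avg (fun x => f x * f x) ≤ avg f := avg_mono fun x => by nlinarith [h0 x, h1 x]
  nlinarith [sq_nonneg (avg f - 1 / 2)]

lemma sum_mj_le (f : (ι → Bool) → ℝ) (h0 : ∀ x, 0 ≤ f x) (h1 : ∀ x, f x ≤ 1) :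
    ∑ j, mj j f ≤ 1 := by
  have a := sum_Hj_self_le f (ρ := 1 / 2) (by norm_num) (by norm_num)
  have b := var_le f h0 h1
  unfold mj
  linarith

lemma sum_sq_le (f : (ι → Bool) → ℝ) (h0 : ∀ x, 0 ≤ f x) (h1 : ∀ x, f x ≤ 1) :
    ∑ j, avg (D j f) ^ 2 ≤ 1 / 4 := by
  have a := sum_Hj_self_le f (ρ := 0) (by norm_num) (by norm_num)
  have b := var_le f h0 h1
  simp only [Hj_eq, H_zero] at a
  simp only [pow_two]
  linarith

/-- Jensen-type inequality. -/
lemma jensen_aux (a b m m' : ι → ℝ) (ha : ∀ j, 0 ≤ a j) (hb : ∀ j, 0 ≤ b j)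
    (hm : ∀ j, a j ^ 2 ≤ m j) (hm' : ∀ j, b j ^ 2 ≤ m' j)
    (h1 : ∑ j, m j ≤ 1) (h2 : ∑ j, m' j ≤ 1) {τ : ℝ} (hτ : 0 ≤ τ) :
    (∑ j, a j * b j) * (∑ j, a j * b j) ^ (2 * τ) ≤
      ∑ j, (a j * (a j ^ 2 / m j) ^ τ) * (b j * (b j ^ 2 / m' j) ^ τ) := by
  set S := ∑ j, a j * b j with hS
  have hS0 : 0 ≤ S := Finset.sum_nonneg fun j _ => mul_nonneg (ha j) (hb j)
  have hm0 : ∀ j, 0 ≤ m j := fun j => (sq_nonneg _).trans (hm j)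
  have hm0' : ∀ j, 0 ≤ m' j := fun j => (sq_nonneg _).trans (hm' j)
  rcases eq_or_lt_of_le hS0 with h | hSp
  · rw [← h, zero_mul]
    exact Finset.sum_nonneg fun j _ => mul_nonneg
      (mul_nonneg (ha j) (Real.rpow_nonneg (div_nonneg (sq_nonneg _) (hm0 j)) _))
      (mul_nonneg (hb j) (Real.rpow_nonneg (div_nonneg (sq_nonneg _) (hm0' j)) _))
  have term : ∀ j, S ^ (2 * τ) * ((1 + 2 * τ) * (a j * b j) - τ * S * (m j + m' j)) ≤
      (a j * (a j ^ 2 / m j) ^ τ) * (b j * (b j ^ 2 / m' j) ^ τ) := by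
    intro j
    have hSτ : 0 < S ^ (2 * τ) := Real.rpow_pos_of_pos hSp _
    rcases eq_or_lt_of_le (mul_nonneg (ha j) (hb j)) with hc | hc
    · have : 0 ≤ τ * S * (m j + m' j) :=
        mul_nonneg (mul_nonneg hτ hS0) (add_nonneg (hm0 j) (hm0' j))
      have e : (a j * (a j ^ 2 / m j) ^ τ) * (b j * (b j ^ 2 / m' j) ^ τ)
          = (a j * b j) * ((a j ^ 2 / m j) ^ τ * (b j ^ 2 / m' j) ^ τ) := by ring
      rw [e, ← hc]
      nlinarith
    · have pa : 0 < a j := lt_of_le_of_ne (ha j) (by rintro h; simp [← h] at hc)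
      have pb : 0 < b j := lt_of_le_of_ne (hb j) (by rintro h; simp [← h] at hc)
      have pm : 0 < m j := lt_of_lt_of_le (by positivity) (hm j)
      have pm' : 0 < m' j := lt_of_lt_of_le (by positivity) (hm' j)
      set z := √(m j * m' j) * S / (a j * b j) with hz
      have pz : 0 < z := by positivity
      have ez : (a j ^ 2 / m j) ^ τ * (b j ^ 2 / m' j) ^ τ
          = S ^ (2 * τ) * Real.exp (-(2 * τ) * Real.log z) := by
        rw [← Real.mul_rpow (by positivity) (by positivity), Real.rpow_mul hSp.le,
          mul_comm (-(2 * τ)), Real.exp_mul, Real.exp_log pz, Real.rpow_neg pz.le,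
          Real.rpow_mul pz.le, ← Real.inv_rpow (by positivity),
          ← Real.mul_rpow (by positivity) (by positivity)]
        congr 1
        rw [hz, Real.rpow_two, Real.rpow_two, div_pow, mul_pow,
          Real.sq_sqrt (by positivity)]
        field_simp
      have l1 := Real.add_one_le_exp (-(2 * τ) * Real.log z)
      have l2 := Real.log_le_sub_one_of_pos pz
      have l3 : 1 + 2 * τ - 2 * τ * z ≤ Real.exp (-(2 * τ) * Real.log z) := by nlinarith
      have l4 : 2 * √(m j * m' j) ≤ m j + m' j := by
        rw [Real.sqrt_mul pm.le]
        nlinarith [sq_nonneg (√(m j) - √(m' j)), Real.sq_sqrt pm.le, Real.sq_sqrt pm'.le]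
      have e : (a j * (a j ^ 2 / m j) ^ τ) * (b j * (b j ^ 2 / m' j) ^ τ)
          = (a j * b j) * ((a j ^ 2 / m j) ^ τ * (b j ^ 2 / m' j) ^ τ) := by ring
      rw [e, ez]
      have e2 : a j * b j * (S ^ (2 * τ) * Real.exp (-(2 * τ) * Real.log z))
        = S ^ (2 * τ) * (a j * b j * Real.exp (-(2 * τ) * Real.log z)) := by ring
      rw [e2]
      refine mul_le_mul_of_nonneg_left ?_ hSτ.le
      have l5 : a j * b j * (1 + 2 * τ - 2 * τ * z) ≤
        a j * b j * Real.exp (-(2 * τ) * Real.log z) := mul_le_mul_of_nonneg_left l3 hc.le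
      have l6 : a j * b j * z = √(m j * m' j) * S := by rw [hz]; field_simp
      have l7 : τ * S * (2 * √(m j * m' j)) ≤ τ * S * (m j + m' j) :=
        mul_le_mul_of_nonneg_left l4 (mul_nonneg hτ hS0)
      nlinarith
  refine le_trans ?_ (Finset.sum_le_sum fun j _ => term j)
  rw [← Finset.mul_sum, Finset.sum_sub_distrib, ← Finset.mul_sum, ← Finset.mul_sum,
    Finset.sum_add_distrib, ← hS, mul_comm]
  refine mul_le_mul_of_nonneg_left ?_ (Real.rpow_nonneg hS0 _)
  nlinarith [mul_nonneg hτ hS0]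

lemma cov_ge_two (f g : (ι → Bool) → ℝ) (hf : ∀ j x, 0 ≤ D j f x) (hg : ∀ j x, 0 ≤ D j g x)
    (hf0 : ∀ x, 0 ≤ f x) (hf1 : ∀ x, f x ≤ 1) (hg0 : ∀ x, 0 ≤ g x) (hg1 : ∀ x, g x ≤ 1)
    {r : ℝ} (hr : 0 < r) (hr1 : r ≤ 1 / 32) :
    r * ((∑ j, avg (D j f) * avg (D j g)) * (∑ j, avg (D j f) * avg (D j g)) ^ (64 * r))
      ≤ avg (fun x => f x * g x) - avg f * avg g := by
  refine le_trans ?_ (cov_ge f g hf hg (fun _ => r) (fun _ => 32 * r) (fun _ => 32 * r)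
    (fun _ => hr.le) (fun _ => by linarith) (fun _ => by linarith) (fun _ => by linarith)
    (fun _ => by linarith) (fun _ => by nlinarith))
  rw [← Finset.mul_sum]
  refine mul_le_mul_of_nonneg_left ?_ hr.le
  have := jensen_aux (fun j => avg (D j f)) (fun j => avg (D j g)) (fun j => mj j f)
    (fun j => mj j g) (fun j => avg_nonneg (hf j)) (fun j => avg_nonneg (hg j))
    (fun j => sq_le_mj j f) (fun j => sq_le_mj j g) (sum_mj_le f hf0 hf1) (sum_mj_le g hg0 hg1)
    (τ := 32 * r) (by linarith)
  rwa [show 2 * (32 * r) = 64 * r by ring] at this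

end
end DPT

set_option linter.unusedSectionVars false

namespace DPT
section
variable {ι : Type*} [Fintype ι] [DecidableEq ι]

lemma avg_D (j : ι) (f : (ι → Bool) → ℝ) : avg (D j f) = avg fun x => f x * sg (x j) := by
  rw [avg_split j (fun x => f x * sg (x j))]
  congr 1; ext x
  simp [D]; ring

lemma D_equiv (e : ι ≃ ι) (f : (ι → Bool) → ℝ) (hf : ∀ x, f (x ∘ e.symm) = f x) (j : ι)
    (x : ι → Bool) : D j f (x ∘ e.symm) = D (e.symm j) f x := by
  have : ∀ b, Function.update (x ∘ e.symm) j b = (Function.update x (e.symm j) b) ∘ e.symm := by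
    intro b
    ext i
    simp only [Function.update_apply, Function.comp, e.symm.injective.eq_iff]
  simp only [D, this, hf]

lemma avg_D_equiv (e : ι ≃ ι) (f : (ι → Bool) → ℝ) (hf : ∀ x, f (x ∘ e.symm) = f x) (j : ι) :
    avg (D j f) = avg (D (e.symm j) f) := by
  rw [avg_equiv e]
  simp only [D_equiv e f hf]

lemma mj_equiv (e : ι ≃ ι) (f : (ι → Bool) → ℝ) (hf : ∀ x, f (x ∘ e.symm) = f x) (j : ι) :
    mj j f = mj (e.symm j) f := by
  unfold mj
  rw [Hj_eq, Hj_eq, H_equiv e]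
  simp only [D_equiv e f hf]
end

section block
variable {n M : ℕ}

/-- invariance under permutations inside the blocks -/
def BlockInv (f : (Fin n × Fin M → Bool) → ℝ) : Prop :=
  ∀ i j j' x, f (x ∘ Equiv.swap (i, j) (i, j')) = f x

/-- normalised block sum -/
noncomputable def Z (i : Fin n) (x : Fin n × Fin M → Bool) : ℝ :=
  (√(M : ℝ))⁻¹ * ∑ j, sg (x (i, j))

lemma avg_D_block {f : (Fin n × Fin M → Bool) → ℝ} (hf : BlockInv f) (hM : 0 < M) (i : Fin n)
    (j : Fin M) : avg (D (i, j) f) = avg (fun x => f x * Z i x) / √(M : ℝ) := by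
  have h : ∀ j', avg (D (i, j') f) = avg (D (i, j) f) := fun j' => by
    have := avg_D_equiv (Equiv.swap (i, j') (i, j)) f (fun x => by
      rw [Equiv.symm_swap]; exact hf _ _ _ _) (i, j')
    rw [this]; simp
  have hM' : (0:ℝ) < M := by exact_mod_cast hM
  have e : avg (fun x => f x * Z i x) = (√(M : ℝ))⁻¹ * ∑ j', avg (D (i, j') f) := by
    simp only [avg_D, ← avg_sum, ← avg_mul_left, Z, Finset.mul_sum]
    congr 1; ext x
    refine Finset.sum_congr rfl fun k _ => by ring
  rw [e, Finset.sum_congr rfl fun j' _ => h j']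
  have := Real.mul_self_sqrt hM'.le
  have h2 : 0 < √(M : ℝ) := Real.sqrt_pos.2 hM'
  simp
  field_simp
  rw [pow_two, this]

lemma mj_block {f : (Fin n × Fin M → Bool) → ℝ} (hf : BlockInv f) (hM : 0 < M)
    (h0 : ∀ x, 0 ≤ f x) (h1 : ∀ x, f x ≤ 1) (i : Fin n) (j : Fin M) :
    mj (i, j) f ≤ 1 / M := by
  have h : ∀ j', mj (i, j') f = mj (i, j) f := fun j' => by
    have := mj_equiv (Equiv.swap (i, j') (i, j)) f (fun x => by
      rw [Equiv.symm_swap]; exact hf _ _ _ _) (i, j')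
    rw [this]; simp
  have hM' : (0:ℝ) < M := by exact_mod_cast hM
  have k := sum_mj_le f h0 h1
  rw [Fintype.sum_prod_type] at k
  have k2 := Finset.single_le_sum (f := fun i => ∑ j, mj (i, j) f)
    (fun i _ => Finset.sum_nonneg fun j _ => mj_nonneg (i, j) f) (Finset.mem_univ i)
  simp only [h] at k2
  simp at k2
  rw [le_div_iff₀ hM']
  linarith

lemma block_term {A s m : ℝ} {M : ℕ} (hM : 0 < M) (hA : 0 ≤ A) (hs : 0 < s)
    (hm : m ≤ 1 / M) (hAm : (A / √(M : ℝ)) ^ 2 ≤ m) :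
    A * (A ^ 2) ^ s ≤ A * ((A / √(M : ℝ)) ^ 2 / m) ^ s := by
  have hM' : (0:ℝ) < M := by exact_mod_cast hM
  rcases eq_or_lt_of_le hA with h | h
  · simp [← h]
  refine mul_le_mul_of_nonneg_left ?_ hA
  refine Real.rpow_le_rpow (by positivity) ?_ hs.le
  have hm0 : 0 < m := lt_of_lt_of_le (by positivity) hAm
  rw [div_pow, Real.sq_sqrt hM'.le, le_div_iff₀ hm0]
  calc A ^ 2 * m ≤ A ^ 2 * (1 / M) := by gcongr
    _ = A ^ 2 / M := by ring

lemma cov_ge_one {f g : (Fin n × Fin M → Bool) → ℝ} (hM : 0 < M)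
    (hf : ∀ j x, 0 ≤ D j f x) (hg : ∀ j x, 0 ≤ D j g x)
    (hf0 : ∀ x, 0 ≤ f x) (hf1 : ∀ x, f x ≤ 1) (hg0 : ∀ x, 0 ≤ g x) (hg1 : ∀ x, g x ≤ 1)
    (hfb : BlockInv f) (hgb : BlockInv g)
    (r s t : Fin n → ℝ) (hr : ∀ j, 0 ≤ r j) (hs : ∀ j, 0 < s j) (hs1 : ∀ j, s j ≤ 1)
    (ht : ∀ j, 0 < t j) (ht1 : ∀ j, t j ≤ 1) (h : ∀ j, 1024 * r j ^ 2 ≤ s j * t j) :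
    ∑ i, r i * ((avg (fun x => f x * Z i x) * (avg (fun x => f x * Z i x) ^ 2) ^ s i) *
      (avg (fun x => g x * Z i x) * (avg (fun x => g x * Z i x) ^ 2) ^ t i))
      ≤ avg (fun x => f x * g x) - avg f * avg g := by
  have hM' : (0:ℝ) < M := by exact_mod_cast hM
  have h2 : 0 < √(M : ℝ) := Real.sqrt_pos.2 hM'
  have hA : ∀ i, 0 ≤ avg (fun x => f x * Z i x) := fun i => by
    have := avg_D_block hfb hM i ⟨0, hM⟩
    have k := avg_nonneg (hf (i, ⟨0, hM⟩))
    rw [this] at k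
    by_contra hc
    exact absurd (div_neg_of_neg_of_pos (not_le.1 hc) h2) (not_lt.2 k)
  have hB : ∀ i, 0 ≤ avg (fun x => g x * Z i x) := fun i => by
    have := avg_D_block hgb hM i ⟨0, hM⟩
    have k := avg_nonneg (hg (i, ⟨0, hM⟩))
    rw [this] at k
    by_contra hc
    exact absurd (div_neg_of_neg_of_pos (not_le.1 hc) h2) (not_lt.2 k)
  refine le_trans ?_ (cov_ge f g hf hg (fun j => r j.1) (fun j => s j.1) (fun j => t j.1)
    (fun _ => hr _) (fun _ => hs _) (fun _ => hs1 _) (fun _ => ht _)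
    (fun _ => ht1 _) (fun _ => h _))
  rw [Fintype.sum_prod_type]
  refine Finset.sum_le_sum fun i _ => ?_
  have step : ∀ j : Fin M, (1 / M : ℝ) * (r i * ((avg (fun x => f x * Z i x) *
      (avg (fun x => f x * Z i x) ^ 2) ^ s i) *
      (avg (fun x => g x * Z i x) * (avg (fun x => g x * Z i x) ^ 2) ^ t i))) ≤
      r i * (avg (D (i, j) f) * (avg (D (i, j) f) ^ 2 / mj (i, j) f) ^ s i *
      (avg (D (i, j) g) * (avg (D (i, j) g) ^ 2 / mj (i, j) g) ^ t i)) := by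
    intro j
    have q1 := sq_le_mj (i, j) f
    have q2 := sq_le_mj (i, j) g
    rw [avg_D_block hfb hM] at q1 ⊢
    rw [avg_D_block hgb hM] at q2 ⊢
    have t1 := block_term hM (hA i) (hs i) (mj_block hfb hM hf0 hf1 i j) q1
    have t2 := block_term hM (hB i) (ht i) (mj_block hgb hM hg0 hg1 i j) q2
    set A := avg (fun x => f x * Z i x)
    set B := avg (fun x => g x * Z i x)
    have e : r i * (A / √(M:ℝ) * ((A / √(M:ℝ)) ^ 2 / mj (i, j) f) ^ s i *
      (B / √(M:ℝ) * ((B / √(M:ℝ)) ^ 2 / mj (i, j) g) ^ t i)) =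
      (1 / M : ℝ) * (r i * ((A * ((A / √(M:ℝ)) ^ 2 / mj (i, j) f) ^ s i) *
      (B * ((B / √(M:ℝ)) ^ 2 / mj (i, j) g) ^ t i))) := by
      generalize ((A / √(M:ℝ)) ^ 2 / mj (i, j) f) ^ s i = U
      generalize ((B / √(M:ℝ)) ^ 2 / mj (i, j) g) ^ t i = V
      have := Real.mul_self_sqrt hM'.le
      field_simp
      rw [pow_two, this]
      ring
    rw [e]
    refine mul_le_mul_of_nonneg_left (mul_le_mul_of_nonneg_left ?_ (hr i)) (by positivity)
    refine mul_le_mul t1 t2 ?_ ?_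
    · exact mul_nonneg (hB i) (Real.rpow_nonneg (sq_nonneg _) _)
    · exact mul_nonneg (hA i) (Real.rpow_nonneg
        (div_nonneg (sq_nonneg _) (mj_nonneg _ _)) _)
  refine le_trans (le_of_eq ?_) (Finset.sum_le_sum fun j _ => step j)
  simp
  field_simp

lemma block_sum {f g : (Fin n × Fin M → Bool) → ℝ} (hM : 0 < M)
    (hfb : BlockInv f) (hgb : BlockInv g) :
    ∑ j, avg (D j f) * avg (D j g) = ∑ i, avg (fun x => f x * Z i x) *
      avg (fun x => g x * Z i x) := by
  have hM' : (0:ℝ) < M := by exact_mod_cast hM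
  rw [Fintype.sum_prod_type]
  refine Finset.sum_congr rfl fun i _ => ?_
  simp only [avg_D_block hfb hM, avg_D_block hgb hM]
  have := Real.mul_self_sqrt hM'.le
  simp
  field_simp
  rw [pow_two, this]
  ring

lemma block_sq_le {f : (Fin n × Fin M → Bool) → ℝ} (hM : 0 < M) (hfb : BlockInv f)
    (hf0 : ∀ x, 0 ≤ f x) (hf1 : ∀ x, f x ≤ 1) :
    ∑ i, avg (fun x => f x * Z i x) ^ 2 ≤ 1 / 4 := by
  have := sum_sq_le f hf0 hf1
  simp only [pow_two] at this ⊢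
  rwa [block_sum hM hfb hfb] at this

end block
end DPT


namespace DPT
section gauss
open Topology

instance : IsProbabilityMeasure _root_.stdGaussian := by unfold _root_.stdGaussian; infer_instance

instance : NullSingletonClass _root_.stdGaussian := nullSingletonClass_gaussianReal one_ne_zero

lemma gphi_eq (u : ℝ) : gphi u = gaussianPDFReal 0 1 u := by
  simp [gphi, gaussianPDFReal]

lemma gphi_neg (u : ℝ) : gphi (-u) = gphi u := by simp [gphi]

lemma Phi_eq_cdf (u : ℝ) : Phi u = cdf _root_.stdGaussian u := by
  rw [cdf_eq_real]; rfl

lemma Phi_continuous : Continuous Phi := by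
  have : Phi = cdf _root_.stdGaussian := by ext; exact Phi_eq_cdf _
  rw [this, continuous_iff_continuousAt]
  intro x
  have h : (cdf _root_.stdGaussian).measure {x} = 0 := by rw [measure_cdf]; simp
  rw [StieltjesFunction.measure_singleton] at h
  rw [(monotone_cdf _root_.stdGaussian).continuousAt_iff_leftLim_eq_rightLim,
    StieltjesFunction.rightLim_eq]
  have h1 := (monotone_cdf _root_.stdGaussian).leftLim_le (le_refl x)
  rw [ENNReal.ofReal_eq_zero] at h
  linarith

lemma Phi_strictMono : StrictMono Phi := by
  intro a b hab
  unfold Phi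
  refine (ENNReal.toReal_lt_toReal (measure_ne_top _ _) (measure_ne_top _ _)).2 ?_
  rw [← Set.Iic_union_Ioc_eq_Iic hab.le, measure_union (Set.Iic_disjoint_Ioc le_rfl)
    measurableSet_Ioc]
  refine ENNReal.lt_add_right (measure_ne_top _ _) ?_
  intro h
  have := gaussianReal_absolutelyContinuous' 0 (v := 1) one_ne_zero h
  simp at this
  linarith

lemma Phi_tendsto_atBot : Tendsto Phi atBot (𝓝 0) := by
  have : Phi = cdf _root_.stdGaussian := by ext; exact Phi_eq_cdf _
  rw [this]; exact tendsto_cdf_atBot _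

lemma Phi_tendsto_atTop : Tendsto Phi atTop (𝓝 1) := by
  have : Phi = cdf _root_.stdGaussian := by ext; exact Phi_eq_cdf _
  rw [this]; exact tendsto_cdf_atTop _

lemma Phi_pos (u : ℝ) : 0 < Phi u :=
  lt_of_le_of_lt (by unfold Phi; positivity) (Phi_strictMono (sub_one_lt u))

lemma exists_Phi {a : ℝ} (h0 : 0 < a) (h1 : a < 1) : ∃ u, Phi u = a := by
  obtain ⟨x, hx⟩ := ((tendsto_order.1 Phi_tendsto_atBot).2 a h0).exists
  obtain ⟨y, hy⟩ := ((tendsto_order.1 Phi_tendsto_atTop).1 a h1).exists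
  exact mem_range_of_exists_le_of_exists_ge Phi_continuous ⟨x, hx.le⟩ ⟨y, hy.le⟩

lemma PhiInv_Phi (u : ℝ) : PhiInv (Phi u) = u := by
  have : {v | Phi u ≤ Phi v} = Set.Ici u := by
    ext v; simp [Phi_strictMono.le_iff_le]
  rw [PhiInv, this, csInf_Ici]

lemma Ioi_eq (t : ℝ) : (_root_.stdGaussian (Set.Ioi t)).toReal = 1 - Phi t := by
  have := prob_compl_eq_one_sub (μ := _root_.stdGaussian) (measurableSet_Iic (a := t))
  rw [Set.compl_Iic] at this
  rw [this, ENNReal.toReal_sub_of_le prob_le_one (by simp)]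
  simp [Phi]

lemma Phi_neg (t : ℝ) : Phi (-t) = 1 - Phi t := by
  rw [← Ioi_eq]
  have h : _root_.stdGaussian.map (fun x => -x) = _root_.stdGaussian := by
    have := gaussianReal_map_neg (μ := 0) (v := 1)
    rw [neg_zero] at this
    exact this
  unfold Phi
  conv_lhs => rw [← h]
  rw [Measure.map_apply (by fun_prop) measurableSet_Iic]
  have : (fun x : ℝ => -x) ⁻¹' Set.Iic (-t) = Set.Ici t := by ext; simp
  rw [this, ← Ioi_ae_eq_Ici.measure_eq]

lemma hfun_upper (t : ℝ) : hfun (1 - Phi t) = gphi t := by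
  rw [← Phi_neg]
  have h1 : Phi (-t) < 1 := by rw [Phi_neg]; linarith [Phi_pos t]
  rw [hfun, if_neg (by push Not; exact ⟨Phi_pos _, h1⟩), PhiInv_Phi, gphi_neg]

lemma integral_Ioi_gauss (t : ℝ) : ∫ z, (Set.Ioi t).indicator (fun z => z) z ∂_root_.stdGaussian = gphi t := by
  unfold _root_.stdGaussian
  rw [integral_gaussianReal_eq_integral_smul one_ne_zero]
  have hd : ∀ x ∈ Set.Ici t, HasDerivAt (fun z => - gphi z) (x * gphi x) x := by
    intro x _
    unfold gphi
    have h1 : HasDerivAt (fun z : ℝ => -(z ^ 2) / 2) (-x) x := by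
      have := (((hasDerivAt_id x).pow 2).neg).div_const 2
      refine this.congr_deriv ?_
      simp
      ring
    have := ((h1.exp).const_mul (√(2 * Real.pi))⁻¹).neg
    refine this.congr_deriv ?_
    ring
  have hInt : Integrable (fun x => x * gphi x) := by
    have h := integrable_mul_exp_neg_mul_sq (b := 1/2) (by norm_num)
    refine (h.const_mul (√(2 * Real.pi))⁻¹).congr (ae_of_all _ fun x => ?_)
    simp only [gphi]
    have : -(1/2 : ℝ) * x ^ 2 = -(x^2)/2 := by ring
    rw [this]; ring
  have hlim : Tendsto (fun z => - gphi z) atTop (𝓝 0) := by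
    rw [← neg_zero]
    refine Tendsto.neg ?_
    unfold gphi
    rw [← mul_zero (√(2 * Real.pi))⁻¹]
    refine Tendsto.const_mul _ ?_
    refine Real.tendsto_exp_atBot.comp ?_
    refine Tendsto.atBot_div_const (by norm_num) ?_
    exact tendsto_neg_atTop_atBot.comp (tendsto_pow_atTop (by norm_num))
  have := integral_Ioi_of_hasDerivAt_of_tendsto' hd hInt.integrableOn hlim
  rw [zero_sub, neg_neg] at this
  rw [← this, ← integral_indicator measurableSet_Ioi]
  congr 1; ext x
  by_cases h : x ∈ Set.Ioi t
  · simp [Set.indicator_of_mem h, gphi_eq, mul_comm]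
  · simp [Set.indicator_of_notMem h]

lemma integral_sq_gauss : ∫ z, z ^ 2 ∂_root_.stdGaussian = 1 := by
  have h := variance_fun_id_gaussianReal (μ := 0) (v := 1)
  rw [variance_eq_integral (by fun_prop)] at h
  unfold _root_.stdGaussian
  simpa using h
end gauss
end DPT


namespace DPT
section clt
open Topology

/-- uniform measure on bits -/
noncomputable def bitM : Measure Bool := (2⁻¹ : ENNReal) • (Measure.dirac true + Measure.dirac false)

instance : IsProbabilityMeasure bitM := ⟨by
  simp only [bitM, Measure.smul_apply, Measure.add_apply, measure_univ, smul_eq_mul]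
  rw [one_add_one_eq_two, ENNReal.inv_mul_cancel] <;> simp⟩

lemma bitM_singleton (b : Bool) : bitM {b} = 2⁻¹ := by
  cases b <;> simp [bitM]

lemma integral_bitM (F : Bool → ℝ) : ∫ b, F b ∂bitM = (F true + F false) / 2 := by
  rw [integral_fintype (by exact Integrable.of_finite)]
  simp [Measure.real, bitM_singleton]
  ring

lemma integral_pi_bitM {M : ℕ} (F : (Fin M → Bool) → ℝ) :
    ∫ x, F x ∂(Measure.pi fun _ => bitM) = avg F := by
  rw [integral_fintype (by exact Integrable.of_finite)]
  simp [Measure.real, Measure.pi_singleton, bitM_singleton, avg, Finset.sum_div]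
  refine Finset.sum_congr rfl fun x _ => by ring

/-- normalised sum -/
noncomputable def Zs {M : ℕ} (x : Fin M → Bool) : ℝ := (√(M : ℝ))⁻¹ * ∑ j, sg (x j)

/-- law of the normalised sum -/
noncomputable def law (M : ℕ) : ProbabilityMeasure ℝ :=
  ⟨(Measure.pi fun _ : Fin M => bitM).map Zs,
    Measure.isProbabilityMeasure_map (measurable_of_finite _).aemeasurable⟩

lemma integral_law (M : ℕ) {F : ℝ → ℝ} (hF : Measurable F) :
    ∫ z, F z ∂(law M : Measure ℝ) = avg fun x : Fin M → Bool => F (Zs x) := by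
  rw [← integral_pi_bitM]
  exact integral_map (measurable_of_finite _).aemeasurable hF.aestronglyMeasurable

lemma charFun_law (M : ℕ) (t : ℝ) :
    charFun (law M : Measure ℝ) t = (charFun (bitM.map sg) ((√(M : ℝ))⁻¹ * t)) ^ M := by
  rw [charFun_apply_real, charFun_apply_real]
  simp only [law, ProbabilityMeasure.coe_mk]
  rw [integral_map (measurable_of_finite _).aemeasurable (by fun_prop),
    integral_map (measurable_of_finite _).aemeasurable (by fun_prop)]
  have := integral_fintype_prod_eq_pow (ι := Fin M) (𝕜 := ℂ) (μ := bitM)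
    (fun b => Complex.exp (((√(M : ℝ))⁻¹ * t : ℝ) * (sg b : ℂ) * Complex.I))
  rw [Fintype.card_fin] at this
  rw [← this]
  congr 1; ext x
  rw [← Complex.exp_sum]
  congr 1
  simp only [Zs]
  push_cast
  rw [← Finset.sum_mul, ← Finset.mul_sum]
  ring

/-- the standard gaussian law -/
noncomputable def gaussP : ProbabilityMeasure ℝ := ⟨_root_.stdGaussian, inferInstance⟩

lemma clt : Tendsto law atTop (𝓝 gaussP) := by
  refine ProbabilityMeasure.tendsto_iff_tendsto_charFun.2 fun t => ?_
  have e : charFun (gaussP : Measure ℝ) t = Complex.exp (- t ^ 2 / 2) := by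
    simp only [gaussP, ProbabilityMeasure.coe_mk, _root_.stdGaussian]
    rw [charFun_gaussianReal]
    simp [neg_div]
  rw [e]
  simp only [charFun_law]
  refine tendsto_charFun_inv_sqrt_mul_pow (measurable_of_finite _).aemeasurable ?_ ?_ t
  · rw [integral_bitM]; simp
  · rw [integral_bitM]; simp

lemma avg_Zs_sq {M : ℕ} (hM : 0 < M) : avg (fun x : Fin M → Bool => Zs x ^ 2) = 1 := by
  have hM' : (0:ℝ) < M := by exact_mod_cast hM
  have h : ∀ x : Fin M → Bool, Zs x ^ 2 = (M : ℝ)⁻¹ * ∑ j, ∑ k, sg (x j) * sg (x k) := by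
    intro x
    rw [Zs, mul_pow, inv_pow, Real.sq_sqrt hM'.le, pow_two, Finset.sum_mul_sum]
  simp only [h]
  rw [avg_mul_left, avg_sum]
  simp only [avg_sum]
  have k : ∀ j k : Fin M, avg (fun x : Fin M → Bool => sg (x j) * sg (x k)) =
      if j = k then 1 else 0 := by
    intro j k
    split_ifs with hjk
    · subst hjk
      have : (fun x : Fin M → Bool => sg (x j) * sg (x j)) = fun _ => 1 := by
        ext x; cases x j <;> simp
      rw [this, avg_const]
    · rw [avg_split j]
      simp [Function.update_of_ne (Ne.symm hjk), avg_const]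
  simp only [k]
  simp
  field_simp

lemma avg_Zs {M : ℕ} : avg (fun x : Fin M → Bool => Zs x) = 0 := by
  simp only [Zs]
  rw [avg_mul_left, avg_sum]
  have k : ∀ j : Fin M, avg (fun x : Fin M → Bool => sg (x j)) = 0 := by
    intro j
    rw [avg_split j]
    simp [avg_const]
  simp [k]

lemma lim_prob (t : ℝ) : Tendsto (fun M => avg fun x : Fin M → Bool => if t < Zs x then 1 else 0)
    atTop (𝓝 (1 - Phi t)) := by
  have h := ProbabilityMeasure.tendsto_measure_of_null_frontier_of_tendsto' clt (E := Set.Ioi t)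
    (by simp [gaussP])
  have h2 := (ENNReal.tendsto_toReal (measure_ne_top _ _)).comp h
  have e : ((gaussP : Measure ℝ) (Set.Ioi t)).toReal = 1 - Phi t := Ioi_eq t
  rw [e] at h2
  refine h2.congr fun M => ?_
  have := integral_law M (F := fun z => if t < z then 1 else 0)
    (Measurable.ite measurableSet_Ioi measurable_const measurable_const)
  rw [← this]
  have e2 : (fun z : ℝ => if t < z then (1:ℝ) else 0) = (Set.Ioi t).indicator 1 := by
    ext z; simp [Set.indicator]
  rw [e2, integral_indicator_one measurableSet_Ioi]
  rfl

lemma trunc_bound (t K z : ℝ) (hK : 0 < K) :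
    |max (z - t) 0 - min (max (z - t) 0) K| ≤ (z ^ 2 + t ^ 2) / K := by
  set w := max (z - t) 0 with hw
  have h0 : 0 ≤ w := le_max_right _ _
  have h2 : w ^ 2 ≤ (z - t) ^ 2 := by
    rcases le_total (z - t) 0 with h | h
    · rw [hw, max_eq_right h]; nlinarith [sq_nonneg (z - t)]
    · rw [hw, max_eq_left h]
  rcases le_total w K with h | h
  · rw [min_eq_left h, sub_self, abs_zero]; positivity
  · rw [min_eq_right h, abs_of_nonneg (by linarith), le_div_iff₀ hK]
    nlinarith [sq_nonneg (z + t), sq_nonneg (w - 2 * K)]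

lemma trunc_bound_int (μ : Measure ℝ) [IsProbabilityMeasure μ] (h2 : Integrable (fun z => z ^ 2) μ)
    (h1 : Integrable (fun z => z) μ)
    (hv : ∫ z, z ^ 2 ∂μ = 1) (t K : ℝ) (hK : 0 < K) :
    |∫ z, max (z - t) 0 ∂μ - ∫ z, min (max (z - t) 0) K ∂μ| ≤ (1 + t ^ 2) / K := by
  have i1 : Integrable (fun z => max (z - t) 0) μ := (h1.sub (integrable_const t)).pos_part
  have i2 : Integrable (fun z => min (max (z - t) 0) K) μ := i1.inf (integrable_const K)
  rw [← integral_sub i1 i2]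
  refine (abs_integral_le_integral_abs).trans ?_
  refine (integral_mono (i1.sub i2).abs ((h2.add (integrable_const (t ^ 2))).div_const K)
    (fun z => trunc_bound t K z hK)).trans ?_
  simp only [Pi.add_apply]
  rw [integral_div, integral_add h2 (integrable_const _), hv]
  simp

lemma lim_pos_part (t : ℝ) : Tendsto (fun M => ∫ z, max (z - t) 0 ∂(law M : Measure ℝ)) atTop
    (𝓝 (∫ z, max (z - t) 0 ∂_root_.stdGaussian)) := by
  rw [Metric.tendsto_atTop']
  intro ε hε
  set K := 4 * (1 + t ^ 2) / ε with hK
  have hK0 : 0 < K := by positivity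
  have hKe : (1 + t ^ 2) / K = ε / 4 := by rw [hK]; field_simp
  let F : BoundedContinuousFunction ℝ ℝ := BoundedContinuousFunction.ofNormedAddCommGroup
    (fun z => min (max (z - t) 0) K) (by fun_prop) K (fun z => by
      rw [Real.norm_eq_abs, abs_of_nonneg (le_min (le_max_right _ _) hK0.le)]
      exact min_le_right _ _)
  have h := ProbabilityMeasure.tendsto_iff_forall_integral_tendsto.1 clt F
  rw [Metric.tendsto_atTop'] at h
  obtain ⟨N, hN⟩ := h (ε / 4) (by positivity)
  refine ⟨N, fun M hM => ?_⟩
  have h1 := hN M hM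
  have hM0 : 0 < M := by omega
  rw [Real.dist_eq] at h1 ⊢
  have fin : ∀ G : ℝ → ℝ, Measurable G → Integrable G (law M : Measure ℝ) := fun G hG => by
    simp only [law, ProbabilityMeasure.coe_mk]
    rw [integrable_map_measure hG.aestronglyMeasurable (measurable_of_finite _).aemeasurable]
    exact Integrable.of_finite
  have b1 := trunc_bound_int (law M : Measure ℝ) (fin _ (by fun_prop)) (fin _ (by fun_prop))
    (by rw [integral_law M (by fun_prop), avg_Zs_sq hM0]) t K hK0
  have g2 : MemLp (fun z : ℝ => z) 2 _root_.stdGaussian := memLp_id_gaussianReal' 2 (by simp)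
  have b2 := trunc_bound_int _root_.stdGaussian g2.integrable_sq (g2.integrable (by simp))
    integral_sq_gauss t K hK0
  rw [hKe] at b1 b2
  have e1 : ∫ z, F z ∂(law M : Measure ℝ) = ∫ z, min (max (z - t) 0) K ∂(law M : Measure ℝ) := rfl
  have e2 : ∫ z, F z ∂(gaussP : Measure ℝ) = ∫ z, min (max (z - t) 0) K ∂_root_.stdGaussian := rfl
  rw [e1, e2] at h1
  rw [abs_le] at b1 b2
  rw [abs_lt] at h1 ⊢
  constructor <;> linarith [b1.1, b1.2, b2.1, b2.2, h1.1, h1.2]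

lemma lim_first (t : ℝ) :
    Tendsto (fun M => avg fun x : Fin M → Bool => if t < Zs x then Zs x else 0)
    atTop (𝓝 (gphi t)) := by
  have e : gphi t = t * (1 - Phi t) + ∫ z, max (z - t) 0 ∂_root_.stdGaussian := by
    rw [← integral_Ioi_gauss, ← Ioi_eq]
    have g2 : MemLp (fun z : ℝ => z) 2 _root_.stdGaussian := memLp_id_gaussianReal' 2 (by simp)
    have i0 := g2.integrable (by simp)
    have i1 : Integrable (fun z => max (z - t) 0) _root_.stdGaussian :=
      (i0.sub (integrable_const t)).pos_part
    have : (_root_.stdGaussian (Set.Ioi t)).toReal = ∫ z, (Set.Ioi t).indicator 1 z ∂_root_.stdGaussian := by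
      rw [integral_indicator_one measurableSet_Ioi]; rfl
    rw [this, ← integral_const_mul, ← integral_add _ i1]
    · congr 1; ext z
      by_cases h : t < z
      · rw [Set.indicator_of_mem (by exact h), Set.indicator_of_mem (by exact h),
          max_eq_left (by linarith)]
        simp
      · rw [Set.indicator_of_notMem (by exact h), Set.indicator_of_notMem (by exact h),
          max_eq_right (by linarith)]
        simp
    · refine Integrable.const_mul ?_ _
      exact (integrable_const (1:ℝ)).indicator measurableSet_Ioi
  rw [e]
  refine (((lim_prob t).const_mul t).add (lim_pos_part t)).congr fun M => ?_
  rw [integral_law M (by fun_prop), ← avg_mul_left, ← avg_add]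
  congr 1; ext x
  split_ifs with h
  · rw [max_eq_left (by linarith)]; ring
  · rw [max_eq_right (by linarith)]; ring
end clt
end DPT

set_option linter.unusedSectionVars false

namespace DPT
section limit
open Topology

variable {q : ℕ}

/-- lower cumulative weight -/
noncomputable def lowW (γ : Measure (Fin q)) (k : Fin q) : ℝ := (γ (Set.Iio k)).toReal

open Classical in
/-- quantile map -/
noncomputable def quant (γ : Measure (Fin q)) [NeZero q] (s : ℝ) : Fin q :=
  (Finset.univ.filter fun k : Fin q => k = 0 ∨ lowW γ k < Phi s).max' ⟨0, by simp⟩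

variable [NeZero q] (γ : Measure (Fin q)) [IsProbabilityMeasure γ]

lemma lowW_mono : Monotone (lowW γ) := fun a b h =>
  ENNReal.toReal_mono (measure_ne_top _ _) (measure_mono (Set.Iio_subset_Iio h))

lemma lowW_zero : lowW γ 0 = 0 := by
  have : Set.Iio (0 : Fin q) = ∅ := by ext k; simp
  simp [lowW, this]

lemma le_quant (k : Fin q) (s : ℝ) : k ≤ quant γ s ↔ lowW γ k < Phi s := by
  classical
  constructor
  · intro h
    have := Finset.max'_mem (Finset.univ.filter fun k : Fin q => k = 0 ∨ lowW γ k < Phi s)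
      ⟨0, by simp⟩
    have h2 : quant γ s = 0 ∨ lowW γ (quant γ s) < Phi s := by
      simpa [quant] using this
    rcases h2 with h2 | h2
    · rw [h2] at h
      have : k = 0 := le_antisymm h (Fin.zero_le _)
      rw [this, lowW_zero]; exact Phi_pos s
    · exact (lowW_mono γ h).trans_lt h2
  · intro h
    exact Finset.le_max' _ _ (by simp [h])

lemma quant_mono : Monotone (quant γ) := fun a b h => by
  rw [le_quant]
  exact ((le_quant γ _ a).1 le_rfl).trans_le (Phi_strictMono.monotone h)

lemma lowW_pos (hγ : ∀ j, 0 < γ {j}) {k : Fin q} (hk : k ≠ 0) : 0 < lowW γ k := by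
  refine ENNReal.toReal_pos ?_ (measure_ne_top _ _)
  intro h
  have h0 : (0 : Fin q) ∈ Set.Iio k := Fin.pos_iff_ne_zero.2 hk
  exact (hγ 0).ne' (measure_mono_null (Set.singleton_subset_iff.2 h0) h)

lemma Ici_eq (k : Fin q) : (γ (Set.Ici k)).toReal = 1 - lowW γ k := by
  have := prob_compl_eq_one_sub (μ := γ) (measurableSet_Iio (a := k))
  rw [Set.compl_Iio] at this
  rw [this, ENNReal.toReal_sub_of_le prob_le_one (by simp)]
  simp [lowW]

lemma lowW_lt_one (hγ : ∀ j, 0 < γ {j}) (k : Fin q) : lowW γ k < 1 := by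
  have h1 : 0 < (γ (Set.Ici k)).toReal := by
    refine ENNReal.toReal_pos ?_ (measure_ne_top _ _)
    intro h
    exact (hγ k).ne' (measure_mono_null (Set.singleton_subset_iff.2 Set.self_mem_Ici) h)
  rw [Ici_eq] at h1; linarith

open Classical in
lemma lim_upper (hγ : ∀ j, 0 < γ {j}) (S : Set (Fin q)) (hS : IsUpperSet S) :
    Tendsto (fun M => avg fun x : Fin M → Bool => if quant γ (Zs x) ∈ S then 1 else 0) atTop
      (𝓝 (γ S).toReal) ∧
    Tendsto (fun M => avg fun x : Fin M → Bool => if quant γ (Zs x) ∈ S then Zs x else 0) atTop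
      (𝓝 (hfun (γ S).toReal)) := by
  rcases S.eq_empty_or_nonempty with h | h
  · subst h
    simp [avg_const, hfun]
  obtain ⟨k, hk⟩ : ∃ k, S = Set.Ici k := by
    obtain ⟨k, hkS, hmin⟩ := Set.exists_min_image S id (Set.toFinite S) h
    exact ⟨k, Set.Subset.antisymm (fun y hy => hmin y hy) (fun y hy => hS hy hkS)⟩
  subst hk
  by_cases k0 : k = 0
  · subst k0
    have : Set.Ici (0 : Fin q) = Set.univ := by ext y; simp
    rw [this]
    simp [avg_const, hfun, avg_Zs]
  obtain ⟨t, ht⟩ := exists_Phi (lowW_pos γ hγ k0) (lowW_lt_one γ hγ k)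
  have e : ∀ s, quant γ s ∈ Set.Ici k ↔ t < s := fun s => by
    rw [Set.mem_Ici, le_quant, ← ht, Phi_strictMono.lt_iff_lt]
  simp only [e, Ici_eq]
  rw [← ht, hfun_upper]
  exact ⟨lim_prob t, lim_first t⟩

/-- limit weight -/
noncomputable def zet (k : Fin q) : ℝ :=
  hfun (γ (Set.Ici k)).toReal - hfun (γ (Set.Ioi k)).toReal

open Classical in
lemma lim_single (hγ : ∀ j, 0 < γ {j}) (k : Fin q) :
    Tendsto (fun M => avg fun x : Fin M → Bool => if quant γ (Zs x) = k then 1 else 0) atTop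
      (𝓝 (γ {k}).toReal) ∧
    Tendsto (fun M => avg fun x : Fin M → Bool => if quant γ (Zs x) = k then Zs x else 0) atTop
      (𝓝 (zet γ k)) := by
  obtain ⟨a1, a2⟩ := lim_upper γ hγ (Set.Ici k) (isUpperSet_Ici k)
  obtain ⟨b1, b2⟩ := lim_upper γ hγ (Set.Ioi k) (isUpperSet_Ioi k)
  have key : ∀ (s c : ℝ), (if quant γ s ∈ Set.Ici k then c else 0) -
      (if quant γ s ∈ Set.Ioi k then c else 0) = if quant γ s = k then c else 0 := by
    intro s c
    simp only [Set.mem_Ici, Set.mem_Ioi]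
    rcases lt_trichotomy (quant γ s) k with h | h | h
    · simp [h.not_ge, h.ne, h.le.not_gt]
    · simp [h]
    · simp [h, h.le, h.ne']
  constructor
  · have e : (γ {k}).toReal = (γ (Set.Ici k)).toReal - (γ (Set.Ioi k)).toReal := by
      have : Set.Ici k = {k} ∪ Set.Ioi k := by
        ext y; simp [le_iff_eq_or_lt, eq_comm]
      rw [this, measure_union (by simp) measurableSet_Ioi,
        ENNReal.toReal_add (measure_ne_top _ _) (measure_ne_top _ _)]
      ring
    rw [e]
    refine (a1.sub b1).congr fun M => ?_
    rw [← avg_sub]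
    congr 1; ext x
    convert key (Zs x) _
  · refine (a2.sub b2).congr fun M => ?_
    rw [← avg_sub]
    congr 1; ext x
    convert key (Zs x) _

open Classical in
lemma sum_zet (hγ : ∀ j, 0 < γ {j}) (S : Set (Fin q)) (hS : IsUpperSet S) :
    ∑ y, (if y ∈ S then zet γ y else 0) = hfun (γ S).toReal := by
  refine tendsto_nhds_unique ?_ (lim_upper γ hγ S hS).2
  have h : Tendsto (fun M => ∑ y, (if y ∈ S then
      (avg fun x : Fin M → Bool => if quant γ (Zs x) = y then Zs x else 0) else 0)) atTop
      (𝓝 (∑ y, (if y ∈ S then zet γ y else 0))) := by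
    refine tendsto_finsetSum _ fun y _ => ?_
    split_ifs
    · exact (lim_single γ hγ y).2
    · exact tendsto_const_nhds
  refine h.congr fun M => ?_
  have : ∀ y, (if y ∈ S then
      (avg fun x : Fin M → Bool => if quant γ (Zs x) = y then Zs x else 0) else 0) =
      avg fun x : Fin M → Bool => if quant γ (Zs x) = y then (if y ∈ S then Zs x else 0) else 0 := by
    intro y
    split_ifs
    · rfl
    · simp [avg_const]
  simp only [this]
  rw [← avg_sum]
  congr 1; ext x
  simp

lemma avg_prod {n M : ℕ} (G : Fin n → (Fin M → Bool) → ℝ) :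
    avg (fun x : Fin n × Fin M → Bool => ∏ l, G l (fun j => x (l, j))) = ∏ l, avg (G l) := by
  simp only [avg, Finset.prod_div_distrib, Fintype.card_prod, Fintype.card_fin, Finset.prod_const,
    Finset.card_univ]
  rw [← pow_mul, mul_comm M n]
  congr 1
  rw [Finset.prod_univ_sum, Fintype.piFinset_univ]
  exact (Equiv.curry (Fin n) (Fin M) Bool).sum_comp (fun y => ∏ l, G l (y l))

open Classical in
/-- pulled back indicator -/
noncomputable def pull {n : ℕ} (A : Set (Fin n → Fin q)) (M : ℕ) (x : Fin n × Fin M → Bool) : ℝ :=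
  if (fun l => quant γ (Z l x)) ∈ A then 1 else 0

lemma Z_eq {n M : ℕ} (l : Fin n) (x : Fin n × Fin M → Bool) : Z l x = Zs fun j => x (l, j) := rfl

open Classical in
lemma pull_eq {n : ℕ} (A : Set (Fin n → Fin q)) (M : ℕ) (x : Fin n × Fin M → Bool) :
    pull γ A M x = ∑ y : Fin n → Fin q, (if y ∈ A then 1 else 0) *
      ∏ l, if quant γ (Z l x) = y l then (1:ℝ) else 0 := by
  rw [Finset.sum_eq_single fun l => quant γ (Z l x)]
  · simp [pull]
  · intro y _ hy
    have : ∃ l, quant γ (Z l x) ≠ y l := by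
      by_contra hc
      push Not at hc
      exact hy (funext fun l => (hc l).symm)
    obtain ⟨l, hl⟩ := this
    rw [Finset.prod_eq_zero (Finset.mem_univ l) (by simp [hl]), mul_zero]
  · simp

lemma pi_toReal {n : ℕ} (A : Set (Fin n → Fin q)) [DecidablePred (· ∈ A)] :
    ((Measure.pi fun _ : Fin n => γ) A).toReal =
      ∑ y : Fin n → Fin q, (if y ∈ A then 1 else 0) * ∏ l, (γ {y l}).toReal := by
  have h := integral_indicator_one (μ := Measure.pi fun _ : Fin n => γ) (s := A)
    (Set.toFinite A).measurableSet
  rw [Measure.real] at h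
  rw [← h, integral_fintype (by exact Integrable.of_finite)]
  refine Finset.sum_congr rfl fun y _ => ?_
  simp [Measure.real, Measure.pi_singleton, Set.indicator, ENNReal.toReal_prod]

open Classical in
lemma lim_pull (hγ : ∀ j, 0 < γ {j}) {n : ℕ} (A : Set (Fin n → Fin q)) :
    Tendsto (fun M => avg (pull γ A M)) atTop
      (𝓝 ((Measure.pi fun _ : Fin n => γ) A).toReal) := by
  rw [pi_toReal]
  have h : Tendsto (fun M => ∑ y : Fin n → Fin q, (if y ∈ A then 1 else 0) * ∏ l,
      avg fun x : Fin M → Bool => if quant γ (Zs x) = y l then (1:ℝ) else 0) atTop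
      (𝓝 (∑ y : Fin n → Fin q, (if y ∈ A then 1 else 0) * ∏ l, (γ {y l}).toReal)) :=
    tendsto_finsetSum _ fun y _ => (tendsto_finsetProd _ fun l _ =>
      (lim_single γ hγ (y l)).1).const_mul _
  refine h.congr fun M => ?_
  have : pull γ A M = fun x => ∑ y : Fin n → Fin q, (if y ∈ A then 1 else 0) *
      ∏ l, if quant γ (Z l x) = y l then (1:ℝ) else 0 := by ext x; exact pull_eq γ A M x
  rw [this, avg_sum]
  refine Finset.sum_congr rfl fun y _ => ?_
  rw [avg_mul_left, ← avg_prod]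
  rfl

open Classical in
lemma hInf_eq (hγ : ∀ j, 0 < γ {j}) {n : ℕ} (A : Set (Fin n → Fin q)) (hA : IncreasingSetQ A)
    (i : Fin n) : hInf γ A i = ∑ y : Fin n → Fin q, (if y ∈ A then 1 else 0) *
      ∏ l, if l = i then zet γ (y l) else (γ {y l}).toReal := by
  have h1 : ∀ x : Fin n → Fin q, hfun ((γ {y : Fin q | Function.update x i y ∈ A}).toReal) =
      ∑ z, if Function.update x i z ∈ A then zet γ z else 0 := by
    intro x
    rw [← sum_zet γ hγ]
    · rfl
    · intro a b hab ha
      refine hA ?_ ha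
      exact update_le_update_iff.2 ⟨hab, fun _ _ => le_rfl⟩
  have h2 : hInf γ A i = ∑ x : Fin n → Fin q, (∏ l, (γ {x l}).toReal) *
      ∑ z, if Function.update x i z ∈ A then zet γ z else 0 := by
    rw [hInf, integral_fintype (by exact Integrable.of_finite)]
    refine Finset.sum_congr rfl fun y _ => ?_
    rw [h1]
    simp [Measure.real, Measure.pi_singleton, ENNReal.toReal_prod]
  have hsum : ∑ w, (γ {w}).toReal = 1 := by
    have h := sum_measureReal_singleton (μ := γ) Finset.univ
    simp only [Measure.real] at h
    rw [h]; simp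
  rw [h2]
  have h3 : (∑ y : Fin n → Fin q, (if y ∈ A then 1 else 0) *
      ∏ l, if l = i then zet γ (y l) else (γ {y l}).toReal) =
      ∑ p : (Fin n → Fin q) × Fin q, (γ {p.2}).toReal * ((if p.1 ∈ A then 1 else 0) *
      ∏ l, if l = i then zet γ (p.1 l) else (γ {p.1 l}).toReal) := by
    rw [Fintype.sum_prod_type]
    refine Finset.sum_congr rfl fun y _ => ?_
    have hc : ∀ c : ℝ, c = ∑ w, (γ {w}).toReal * c := fun c => by
      rw [← Finset.sum_mul, hsum, one_mul]
    exact hc _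
  rw [h3]
  have h4 : (∑ x : Fin n → Fin q, (∏ l, (γ {x l}).toReal) *
      ∑ z, if Function.update x i z ∈ A then zet γ z else 0) =
      ∑ p : (Fin n → Fin q) × Fin q, (∏ l, (γ {p.1 l}).toReal) *
      if Function.update p.1 i p.2 ∈ A then zet γ p.2 else 0 := by
    rw [Fintype.sum_prod_type]
    simp only [Finset.mul_sum]
  rw [h4]
  refine Finset.sum_nbij' (fun p => (Function.update p.1 i p.2, p.1 i))
    (fun p => (Function.update p.1 i p.2, p.1 i)) (by simp) (by simp) (by simp) (by simp) ?_
  rintro ⟨x, z⟩ _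
  simp only [Function.update_self]
  rw [← Finset.mul_prod_erase Finset.univ _ (Finset.mem_univ i),
    ← Finset.mul_prod_erase Finset.univ (fun l => if l = i then _ else _) (Finset.mem_univ i)]
  have : ∏ l ∈ Finset.univ.erase i, (if l = i then zet γ (Function.update x i z l) else
      (γ {Function.update x i z l}).toReal) = ∏ l ∈ Finset.univ.erase i, (γ {x l}).toReal := by
    refine Finset.prod_congr rfl fun l hl => ?_
    have := Finset.ne_of_mem_erase hl
    simp [this]
  rw [this]
  simp only [if_true, Function.update_self]
  split_ifs <;> ring

open Classical in
lemma lim_pull_Z (hγ : ∀ j, 0 < γ {j}) {n : ℕ} (A : Set (Fin n → Fin q)) (hA : IncreasingSetQ A)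
    (i : Fin n) :
    Tendsto (fun M => avg (fun x => pull γ A M x * Z i x)) atTop (𝓝 (hInf γ A i)) := by
  rw [hInf_eq γ hγ A hA]
  have h : Tendsto (fun M => ∑ y : Fin n → Fin q, (if y ∈ A then 1 else 0) * ∏ l,
      avg fun x : Fin M → Bool => if quant γ (Zs x) = y l then (if l = i then Zs x else 1) else 0)
      atTop (𝓝 (∑ y : Fin n → Fin q, (if y ∈ A then 1 else 0) *
      ∏ l, if l = i then zet γ (y l) else (γ {y l}).toReal)) := by
    refine tendsto_finsetSum _ fun y _ => (tendsto_finsetProd _ fun l _ => ?_).const_mul _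
    by_cases hl : l = i
    · simp only [hl, if_true]; exact (lim_single γ hγ (y i)).2
    · simp only [hl, if_false]; exact (lim_single γ hγ (y l)).1
  refine h.congr fun M => ?_
  have : (fun x => pull γ A M x * Z i x) = fun x => ∑ y : Fin n → Fin q, (if y ∈ A then 1 else 0) *
      ∏ l, if quant γ (Z l x) = y l then (if l = i then Z l x else 1) else 0 := by
    ext x
    rw [pull_eq γ A M x, Finset.sum_mul]
    refine Finset.sum_congr rfl fun y _ => ?_
    rw [mul_assoc]
    congr 1
    have : Z i x = ∏ l, if l = i then Z l x else 1 := by simp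
    rw [this, ← Finset.prod_mul_distrib]
    refine Finset.prod_congr rfl fun l _ => ?_
    split_ifs <;> simp
  rw [this, avg_sum]
  refine Finset.sum_congr rfl fun y _ => ?_
  rw [avg_mul_left, ← avg_prod]
  rfl

lemma pull_nonneg {n : ℕ} (A : Set (Fin n → Fin q)) (M : ℕ) (x) : 0 ≤ pull γ A M x := by
  unfold pull; split_ifs <;> norm_num

lemma pull_le_one {n : ℕ} (A : Set (Fin n → Fin q)) (M : ℕ) (x) : pull γ A M x ≤ 1 := by
  unfold pull; split_ifs <;> norm_num

lemma pull_inter {n : ℕ} (A B : Set (Fin n → Fin q)) (M : ℕ) :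
    pull γ (A ∩ B) M = fun x => pull γ A M x * pull γ B M x := by
  classical
  ext x
  simp only [pull, Set.mem_inter_iff]
  by_cases h1 : (fun l => quant γ (Z l x)) ∈ A <;>
    by_cases h2 : (fun l => quant γ (Z l x)) ∈ B <;> simp [h1, h2]

lemma pull_D {n : ℕ} (A : Set (Fin n → Fin q)) (hA : IncreasingSetQ A) (M : ℕ)
    (j : Fin n × Fin M) (x) : 0 ≤ D j (pull γ A M) x := by
  have key : pull γ A M (Function.update x j false) ≤ pull γ A M (Function.update x j true) := by
    have hle : ∀ l, Z l (Function.update x j false) ≤ Z l (Function.update x j true) := by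
      intro l
      unfold Z
      refine mul_le_mul_of_nonneg_left (Finset.sum_le_sum fun k _ => ?_) (by positivity)
      by_cases h : (l, k) = j
      · rw [h]; simp; 
      · simp [Function.update_of_ne h]
    unfold pull
    split_ifs with h1 h2 h2
    · rfl
    · exact absurd (hA (fun l => quant_mono γ (hle l)) h1) h2
    · norm_num
    · rfl
  unfold D
  linarith

lemma pull_block {n : ℕ} (A : Set (Fin n → Fin q)) (M : ℕ) : BlockInv (pull γ A M) := by
  intro i j j' x
  have : ∀ l, Z l (x ∘ Equiv.swap (i, j) (i, j')) = Z l x := by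
    intro l
    unfold Z
    congr 1
    by_cases h : l = i
    · subst h
      rw [← Equiv.sum_comp (Equiv.swap j j') (fun k => sg (x (l, k)))]
      refine Finset.sum_congr rfl fun k _ => ?_
      have : Equiv.swap (l, j) (l, j') (l, k) = (l, Equiv.swap j j' k) := by
        simp only [Equiv.swap_apply_def, Prod.mk.injEq, true_and]
        split_ifs <;> rfl
      simp [this]
    · refine Finset.sum_congr rfl fun k _ => ?_
      rw [Function.comp, Equiv.swap_apply_of_ne_of_ne] <;> simp [h]
  have e : (fun l => quant γ (Z l (x ∘ Equiv.swap (i, j) (i, j')))) = fun l => quant γ (Z l x) := by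
    ext l; rw [this]
  unfold pull
  rw [e]
end limit
end DPT

set_option linter.unusedSectionVars false

namespace DPT
section final
open Topology

variable {q : ℕ} [NeZero q] (γ : Measure (Fin q)) [IsProbabilityMeasure γ]

/-- covariance -/
noncomputable def Cv {n : ℕ} (A B : Set (Fin n → Fin q)) : ℝ :=
  ((Measure.pi fun _ : Fin n => γ) (A ∩ B)).toReal -
    ((Measure.pi fun _ : Fin n => γ) A).toReal * ((Measure.pi fun _ : Fin n => γ) B).toReal

lemma lim_cov (hγ : ∀ j, 0 < γ {j}) {n : ℕ} (A B : Set (Fin n → Fin q)) :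
    Tendsto (fun M => avg (fun x => pull γ A M x * pull γ B M x) - avg (pull γ A M) *
      avg (pull γ B M)) atTop (𝓝 (Cv γ A B)) := by
  have h := lim_pull γ hγ (A ∩ B)
  simp only [pull_inter] at h
  exact h.sub ((lim_pull γ hγ A).mul (lim_pull γ hγ B))

variable {n : ℕ} {A B : Set (Fin n → Fin q)}

lemma Cv_nonneg (hγ : ∀ j, 0 < γ {j}) (hA : IncreasingSetQ A) (hB : IncreasingSetQ B) :
    0 ≤ Cv γ A B :=
  ge_of_tendsto' (lim_cov γ hγ A B) fun M => cov_nonneg _ _ (pull_D γ A hA M) (pull_D γ B hB M)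

lemma hInf_nonneg (γ : Measure (Fin q)) (A : Set (Fin n → Fin q)) (i : Fin n) : 0 ≤ hInf γ A i := by
  refine integral_nonneg fun x => ?_
  simp only [Pi.zero_apply, hfun, gphi]
  split_ifs
  · exact le_rfl
  · positivity

lemma sum_sq_hInf (hγ : ∀ j, 0 < γ {j}) (hA : IncreasingSetQ A) :
    ∑ i, hInf γ A i ^ 2 ≤ 1 / 4 := by
  refine le_of_tendsto (tendsto_finsetSum _ fun i _ => (lim_pull_Z γ hγ A hA i).pow 2) ?_
  filter_upwards [eventually_gt_atTop 0] with M hM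
  exact block_sq_le hM (pull_block γ A M) (pull_nonneg γ A M) (pull_le_one γ A M)

lemma Cv_ge_one (hγ : ∀ j, 0 < γ {j}) (hA : IncreasingSetQ A) (hB : IncreasingSetQ B)
    (r s t : Fin n → ℝ) (hr : ∀ j, 0 ≤ r j) (hs : ∀ j, 0 < s j) (hs1 : ∀ j, s j ≤ 1)
    (ht : ∀ j, 0 < t j) (ht1 : ∀ j, t j ≤ 1) (h : ∀ j, 1024 * r j ^ 2 ≤ s j * t j) :
    ∑ i, r i * ((hInf γ A i * (hInf γ A i ^ 2) ^ s i) *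
      (hInf γ B i * (hInf γ B i ^ 2) ^ t i)) ≤ Cv γ A B := by
  refine le_of_tendsto_of_tendsto (tendsto_finsetSum _ fun i _ => Tendsto.const_mul (r i)
    (Tendsto.mul
      ((lim_pull_Z γ hγ A hA i).mul (((lim_pull_Z γ hγ A hA i).pow 2).rpow_const (Or.inr (hs i).le)))
      ((lim_pull_Z γ hγ B hB i).mul (((lim_pull_Z γ hγ B hB i).pow 2).rpow_const (Or.inr (ht i).le)))))
    (lim_cov γ hγ A B) ?_
  filter_upwards [eventually_gt_atTop 0] with M hM
  exact cov_ge_one hM (pull_D γ A hA M) (pull_D γ B hB M) (pull_nonneg γ A M) (pull_le_one γ A M)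
    (pull_nonneg γ B M) (pull_le_one γ B M) (pull_block γ A M) (pull_block γ B M)
    r s t hr hs hs1 ht ht1 h

lemma Cv_ge_two (hγ : ∀ j, 0 < γ {j}) (hA : IncreasingSetQ A) (hB : IncreasingSetQ B)
    (r : ℝ) (hr : 0 < r) (hr1 : r ≤ 1 / 32) :
    r * ((∑ i, hInf γ A i * hInf γ B i) * (∑ i, hInf γ A i * hInf γ B i) ^ (64 * r))
      ≤ Cv γ A B := by
  have h : Tendsto (fun M => ∑ i, avg (fun x => pull γ A M x * Z i x) *
      avg (fun x => pull γ B M x * Z i x)) atTop (𝓝 (∑ i, hInf γ A i * hInf γ B i)) :=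
    tendsto_finsetSum _ fun i _ => (lim_pull_Z γ hγ A hA i).mul (lim_pull_Z γ hγ B hB i)
  refine le_of_tendsto_of_tendsto
    ((h.mul (h.rpow_const (Or.inr (by positivity : 0 ≤ 64 * r)))).const_mul r)
    (lim_cov γ hγ A B) ?_
  filter_upwards [eventually_gt_atTop 0] with M hM
  have := cov_ge_two (pull γ A M) (pull γ B M) (pull_D γ A hA M) (pull_D γ B hB M)
    (pull_nonneg γ A M) (pull_le_one γ A M)
    (pull_nonneg γ B M) (pull_le_one γ B M) hr hr1
  rwa [block_sum hM (pull_block γ A M) (pull_block γ B M)] at this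

lemma hInf_le (hγ : ∀ j, 0 < γ {j}) (hA : IncreasingSetQ A) (i : Fin n) : hInf γ A i ≤ 1 / 2 := by
  have h := sum_sq_hInf γ hγ hA
  have h2 := Finset.single_le_sum (f := fun i => hInf γ A i ^ 2) (fun i _ => sq_nonneg _)
    (Finset.mem_univ i)
  nlinarith [hInf_nonneg γ A i]

lemma log_half {u : ℝ} (hu : 0 < u) (hu1 : u ≤ 1 / 2) : 1 / 2 ≤ Real.log (1 / u) := by
  have h1 : Real.log 2 ≤ Real.log (1 / u) := by
    refine Real.log_le_log (by norm_num) ?_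
    rw [le_div_iff₀ hu]; linarith
  linarith [Real.log_two_gt_d9]

lemma rpow_exp {u : ℝ} (hu : 0 < u) (hu1 : u ≤ 1 / 2) :
    (u ^ 2) ^ (1 / (2 * Real.log (1 / u))) = Real.exp (-1) := by
  have hL := log_half hu hu1
  rw [Real.rpow_def_of_pos (by positivity), Real.log_pow]
  have : Real.log u = - Real.log (1 / u) := by rw [one_div, Real.log_inv]; ring
  rw [this]
  congr 1
  have : Real.log (1 / u) ≠ 0 := by linarith
  push_cast
  field_simp

lemma part_one (hγ : ∀ j, 0 < γ {j}) (hA : IncreasingSetQ A) (hB : IncreasingSetQ B) :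
    Real.exp (-2) / 64 * ∑ i, hInf γ A i * hInf γ B i /
      Real.sqrt (Real.log (1 / hInf γ A i) * Real.log (1 / hInf γ B i)) ≤ Cv γ A B := by
  classical
  set u := fun i => hInf γ A i with hu
  set v := fun i => hInf γ B i with hv
  have u0 : ∀ i, 0 ≤ u i := fun i => hInf_nonneg γ A i
  have v0 : ∀ i, 0 ≤ v i := fun i => hInf_nonneg γ B i
  have u1 : ∀ i, u i ≤ 1 / 2 := hInf_le γ hγ hA
  have v1 : ∀ i, v i ≤ 1 / 2 := hInf_le γ hγ hB
  let P : Fin n → Prop := fun i => 0 < u i ∧ 0 < v i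
  let r : Fin n → ℝ := fun i => if P i then
    1 / (64 * √(Real.log (1 / u i) * Real.log (1 / v i))) else 0
  let s : Fin n → ℝ := fun i => if P i then 1 / (2 * Real.log (1 / u i)) else 1
  let t : Fin n → ℝ := fun i => if P i then 1 / (2 * Real.log (1 / v i)) else 1
  have key := Cv_ge_one γ hγ hA hB r s t ?_ ?_ ?_ ?_ ?_ ?_
  · refine le_trans (le_of_eq ?_) key
    rw [Finset.mul_sum]
    refine Finset.sum_congr rfl fun i _ => ?_
    change Real.exp (-2) / 64 * (u i * v i / √(Real.log (1 / u i) * Real.log (1 / v i))) =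
      r i * ((u i * (u i ^ 2) ^ s i) * (v i * (v i ^ 2) ^ t i))
    by_cases hP : P i
    · simp only [r, s, t, if_pos hP]
      rw [rpow_exp hP.1 (u1 i), rpow_exp hP.2 (v1 i)]
      have : Real.exp (-2) = Real.exp (-1) * Real.exp (-1) := by
        rw [← Real.exp_add]; norm_num
      rw [this]
      have : 0 < √(Real.log (1 / u i) * Real.log (1 / v i)) := Real.sqrt_pos.2
        (mul_pos (by linarith [log_half hP.1 (u1 i)]) (by linarith [log_half hP.2 (v1 i)]))
      field_simp
    · simp only [r, if_neg hP, zero_mul]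
      have : u i * v i = 0 := by
        by_contra hc
        have h1 : u i ≠ 0 := fun h => hc (by rw [h, zero_mul])
        have h2 : v i ≠ 0 := fun h => hc (by rw [h, mul_zero])
        exact hP ⟨lt_of_le_of_ne (u0 i) h1.symm, lt_of_le_of_ne (v0 i) h2.symm⟩
      rw [this]; simp
  · intro i
    simp only [r]
    split_ifs <;> positivity
  · intro i
    simp only [s]
    split_ifs with hP
    · have := log_half hP.1 (u1 i)
      positivity
    · norm_num
  · intro i
    simp only [s]
    split_ifs with hP
    · have := log_half hP.1 (u1 i)
      rw [div_le_one (by linarith)]; linarith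
    · norm_num
  · intro i
    simp only [t]
    split_ifs with hP
    · have := log_half hP.2 (v1 i)
      positivity
    · norm_num
  · intro i
    simp only [t]
    split_ifs with hP
    · have := log_half hP.2 (v1 i)
      rw [div_le_one (by linarith)]; linarith
    · norm_num
  · intro i
    simp only [r, s, t]
    split_ifs with hP
    · have h1 := log_half hP.1 (u1 i)
      have h2 := log_half hP.2 (v1 i)
      have : 0 < Real.log (1 / u i) := by linarith
      have : 0 < Real.log (1 / v i) := by linarith
      rw [div_pow, mul_pow, Real.sq_sqrt (by positivity)]
      apply le_of_eq
      field_simp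
      norm_num
    · norm_num

lemma part_two (hγ : ∀ j, 0 < γ {j}) (hA : IncreasingSetQ A) (hB : IncreasingSetQ B) :
    Real.exp (-2) / 64 * ((∑ i, hInf γ A i * hInf γ B i) /
      Real.log (Real.exp 1 / ∑ i, hInf γ A i * hInf γ B i)) ≤ Cv γ A B := by
  have hS1 : ∑ i, hInf γ A i * hInf γ B i ≤ 1 / 4 := by
    have h1 := sum_sq_hInf γ hγ hA
    have h2 := sum_sq_hInf γ hγ hB
    have h3 : ∑ i, hInf γ A i * hInf γ B i ≤ ∑ i, (hInf γ A i ^ 2 + hInf γ B i ^ 2) / 2 :=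
      Finset.sum_le_sum fun i _ => by nlinarith [sq_nonneg (hInf γ A i - hInf γ B i)]
    rw [← Finset.sum_div, Finset.sum_add_distrib] at h3
    linarith
  have hS0 : 0 ≤ ∑ i, hInf γ A i * hInf γ B i :=
    Finset.sum_nonneg fun i _ => mul_nonneg (hInf_nonneg γ A i) (hInf_nonneg γ B i)
  have key := Cv_ge_two γ hγ hA hB
  have hc := Cv_nonneg γ hγ hA hB
  generalize ∑ i, hInf γ A i * hInf γ B i = S at *
  generalize Cv γ A B = C at *
  rcases eq_or_lt_of_le hS0 with h | h
  · rw [← h]; simpa using hc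
  have hl : Real.log S ≤ 0 := Real.log_nonpos hS0 (by linarith)
  have hL : Real.log (Real.exp 1 / S) = 1 - Real.log S := by
    rw [Real.log_div (Real.exp_pos 1).ne' h.ne', Real.log_exp]
  rw [hL]
  set L := 1 - Real.log S with hLd
  have hL1 : 1 ≤ L := by linarith
  have k := key (1 / (64 * L)) (by positivity) (by
    rw [div_le_div_iff₀ (by positivity) (by norm_num)]; linarith)
  refine le_trans ?_ k
  have e : 64 * (1 / (64 * L)) = 1 / L := by field_simp
  rw [e]
  have hp : Real.exp (-2) ≤ S ^ (1 / L) := by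
    rw [Real.rpow_def_of_pos h]
    refine Real.exp_le_exp.2 ?_
    rw [mul_one_div, le_div_iff₀ (by linarith)]
    linarith
  calc Real.exp (-2) / 64 * (S / L) = 1 / (64 * L) * (S * Real.exp (-2)) := by field_simp
    _ ≤ _ := by gcongr
end final
end DPT

/-- **Theorem (Talagrand correlation bound for discrete product spaces).**
There is a universal constant `c > 0` such that for every `q > 1`, every probability
measure `γ` on `[q]` with all atoms positive, every `n` and every pair of increasing sets
`A, B ⊆ [q]ⁿ`, with `h(t) = φ(Φ⁻¹(t))`,
`γ^{⊗n}(A ∩ B) − γ^{⊗n}(A)·γ^{⊗n}(B) ≥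
  c·max(∑ i, I_i^h(A)·I_i^h(B) / √(log(1/I_i^h(A))·log(1/I_i^h(B))),
        φ̃(∑ i, I_i^h(A)·I_i^h(B)))` where `φ̃(x) = x / log(e/x)`. -/
theorem discrete_product_talagrand :
    ∃ c : ℝ, 0 < c ∧
      ∀ (q : ℕ), 1 < q → ∀ (γ : Measure (Fin q)), IsProbabilityMeasure γ →
        (∀ j : Fin q, 0 < γ {j}) →
        ∀ (n : ℕ) (A B : Set (Fin n → Fin q)),
          IncreasingSetQ A → IncreasingSetQ B →
          ((Measure.pi fun _ : Fin n => γ) (A ∩ B)).toReal -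
              ((Measure.pi fun _ : Fin n => γ) A).toReal *
                ((Measure.pi fun _ : Fin n => γ) B).toReal ≥
            c * max
              (∑ i, hInf γ A i * hInf γ B i /
                Real.sqrt (Real.log (1 / hInf γ A i) * Real.log (1 / hInf γ B i)))
              ((∑ i, hInf γ A i * hInf γ B i) /
                Real.log (Real.exp 1 / ∑ i, hInf γ A i * hInf γ B i)) := by
  refine ⟨Real.exp (-2) / 64, by positivity, ?_⟩
  intro q hq γ hγp hγ n A B hA hB
  haveI : NeZero q := ⟨by omega⟩
  have h1 := DPT.part_one γ hγ hA hB
  have h2 := DPT.part_two γ hγ hA hB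
  rw [ge_iff_le, mul_max_of_nonneg _ _ (by positivity)]
  exact max_le h1 h2
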